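/- Hecke-type recursion for the normalized partition function at s_i, 1 ≤ i ≤ n−1: Assume 1 ≤ i ≤ n−1 and σ(i+1) > σ(i) (in the color order), and let s_i ∈ B_n be the transposition (i, i+1) with s_i·x := (x_1,…,x_{i+1},x_i,…,x_n). Then F_μ^{σ s_i}(x) = ((q−1)x_{i+1}/(x_{i+1}−x_i)) · F_μ^σ(x) + ((x_{i+1}−q x_i)/(x_{i+1}−x_i)) · F_μ^σ(s_i·x), provided x_i ≠ x_{i+1} and all denominators appearing are nonzero. Equivalently, F_μ^{σ s_i} = T_i F_μ^σ, where T_i g := q·g + ((x_{i+1}−q x_i)/(x_{i+1}−x_i))·(s_i g − g) is the Demazure–Lusztig operator of the Noumi representation of the affine Hecke algebra of type C̃_n. -/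

import Mathlib

open scoped BigOperators

/-- The set of colors `{0} ∪ [±n]`, encoded as `Fin (2*n+1)`:
index `i < n` is the positive color `i+1`, index `n` is the color `0`,
and index `k > n` is the negative color `\overline{2*n+1-k}`.
The order on `Fin (2*n+1)` is exactly the color order
`1 < ⋯ < n < 0 < n̄ < ⋯ < 1̄`. -/
abbrev Col (n : ℕ) := Fin (2*n+1)

/-- The color `0` (identified with the `+` spin). -/
def mid (n : ℕ) : Col n := ⟨n, by omega⟩

/-- The bar involution `i ↦ ī` on colors (fixing `0`). -/
def barC (n : ℕ) (c : Col n) : Col n := ⟨2*n - c.val, by omega⟩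

/-- The positive color `i+1` attached to `i : Fin n`. -/
def posC (n : ℕ) (i : Fin n) : Col n := ⟨i.val, by have := i.isLt; omega⟩

/-- Vectors `I ∈ ℕ^{2n}` indexed by the colors `[±n]` (the entry at the
color `0` is irrelevant/always `0`). -/
abbrev Vec (n : ℕ) := Col n → ℕ

/-- `e_j`: the standard basis vector for `j ∈ [±n]`, and `e_0 = 0`. -/
def eV (n : ℕ) (c : Col n) : Vec n := fun k => if c ≠ mid n ∧ k = c then 1 else 0

/-- `I_{[1,n]}`. -/
def sLo (n : ℕ) (I : Vec n) : ℕ := ∑ k ∈ Finset.univ.filter (fun k : Col n => k < mid n), I k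
/-- `I_{[n̄,1̄]}`. -/
def sHi (n : ℕ) (I : Vec n) : ℕ := ∑ k ∈ Finset.univ.filter (fun k : Col n => mid n < k), I k
/-- `I_{≤ l}`. -/
def sLe (n : ℕ) (I : Vec n) (l : Col n) : ℕ := ∑ k ∈ Finset.univ.filter (fun k : Col n => k ≤ l), I k
/-- `I_{< l}`. -/
def sLt (n : ℕ) (I : Vec n) (l : Col n) : ℕ := ∑ k ∈ Finset.univ.filter (fun k : Col n => k < l), I k
/-- `I_{> l}`. -/
def sGt (n : ℕ) (I : Vec n) (l : Col n) : ℕ := ∑ k ∈ Finset.univ.filter (fun k : Col n => l < k), I k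
/-- `I_{≥ l}`. -/
def sGe (n : ℕ) (I : Vec n) (l : Col n) : ℕ := ∑ k ∈ Finset.univ.filter (fun k : Col n => l ≤ k), I k

/-- The Boltzmann weight `L_x(I, j, K, ℓ)` of a Γ vertex (Table 2.1). -/
noncomputable def LW (n : ℕ) (q s x : ℂ) (I : Vec n) (j : Col n) (K : Vec n) (l : Col n) : ℂ :=
  if ∀ k, I k + eV n j k = K k + eV n l k then
    if j = l then
      if l = mid n then (q ^ (-(sLo n I : ℤ)) - s * x * q ^ (sHi n I : ℤ)) / (1 - s * x)
      else if l < mid n then (s * q ^ (I l : ℤ) - x) * q ^ (-(sLe n I l : ℤ)) / (s * (1 - s * x))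
      else s * (s * q ^ (I l : ℤ) - x) * q ^ (sGt n I l : ℤ) / (1 - s * x)
    else if j < l then
      if l = mid n then (x * q ^ (-(sLo n I : ℤ)) - s ^ 2 * x * q ^ (sHi n I : ℤ)) / (s * (1 - s * x))
      else if l < mid n then -x * (1 - q ^ (I l : ℤ)) * q ^ (-(sLe n I l : ℤ)) / (s * (1 - s * x))
      else -(s * x) * (1 - q ^ (I l : ℤ)) * q ^ (sGt n I l : ℤ) / (1 - s * x)
    else
      if l = mid n then (q ^ (-(sLo n I : ℤ)) - s ^ 2 * q ^ (sHi n I : ℤ)) / (1 - s * x)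
      else if l < mid n then -(1 - q ^ (I l : ℤ)) * q ^ (-(sLe n I l : ℤ)) / (1 - s * x)
      else -(s ^ 2) * (1 - q ^ (I l : ℤ)) * q ^ (sGt n I l : ℤ) / (1 - s * x)
  else 0

/-- The Boltzmann weight `M_x(I, j, K, ℓ)` of a Δ vertex (Table 2.2). -/
noncomputable def MW (n : ℕ) (q s x : ℂ) (I : Vec n) (j : Col n) (K : Vec n) (l : Col n) : ℂ :=
  if ∀ k, I k + eV n j k = K k + eV n l k then
    if j = l then
      if l = mid n then (q ^ (-(sHi n I : ℤ)) - s * x * q ^ (sLo n I : ℤ)) / (1 - s * x)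
      else if l < mid n then s * (s * q ^ (I l : ℤ) - x) * q ^ (sLt n I l : ℤ) / (1 - s * x)
      else (1 - s⁻¹ * x * q ^ (-(I l : ℤ))) * q ^ (-(sGt n I l : ℤ)) / (1 - s * x)
    else if j < l then
      if l = mid n then (q ^ (-(sHi n I : ℤ)) - s ^ 2 * q ^ (sLo n I : ℤ)) / (1 - s * x)
      else if l < mid n then -(s ^ 2) * (1 - q ^ (I l : ℤ)) * q ^ (sLt n I l : ℤ) / (1 - s * x)
      else -(1 - q ^ (I l : ℤ)) * q ^ (-(sGe n I l : ℤ)) / (1 - s * x)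
    else
      if l = mid n then x * (s⁻¹ * q ^ (-(sHi n I : ℤ)) - s * q ^ (sLo n I : ℤ)) / (1 - s * x)
      else if l < mid n then -(s * x) * (1 - q ^ (I l : ℤ)) * q ^ (sLt n I l : ℤ) / (1 - s * x)
      else -(s⁻¹ * x) * (1 - q ^ (I l : ℤ)) * q ^ (-(sGe n I l : ℤ)) / (1 - s * x)
  else 0

/-- `φ(z) = (1-z²)/((1-νtz)(1+ν⁻¹z))`. -/
noncomputable def phiF (ν t z : ℂ) : ℂ := (1 - z ^ 2) / ((1 - ν * t * z) * (1 + ν⁻¹ * z))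

/-- The cap vertex Boltzmann weight `Cap_x(ε → ε')` (Figure 2.3), where `ε` is
the incoming bottom color and `ε'` the outgoing top color, and `qh` denotes the
fixed branch of `q^{-1/2}`. -/
noncomputable def capW (n : ℕ) (ν t qh x : ℂ) (ε ε' : Col n) : ℂ :=
  if ε = mid n ∧ ε' = mid n then 1
  else if ε < mid n ∧ ε' = barC n ε then t * phiF ν t (qh * x⁻¹)
  else if ε < mid n ∧ ε' = ε then 1 - t * phiF ν t (qh * x⁻¹)
  else if mid n < ε ∧ ε' = barC n ε then phiF ν t (qh * x⁻¹)
  else if mid n < ε ∧ ε' = ε then 1 - phiF ν t (qh * x⁻¹)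
  else 0

/-- A state of the model on the `2n × L` lattice: the first component assigns a
color to each horizontal edge (row `r : Fin (2n)`, 0-indexed top to bottom, and
horizontal position `p : Fin (L+1)`, with `p = 0` the right boundary and
`p = L` the left boundary; the vertex in the paper's column `c+1` of row `r+1`
lies between positions `c` (east) and `c+1` (west)); the second component
assigns a vector in `ℕ^{2n}` to each vertical edge (level `v : Fin (2n+1)`,
with `v = 0` the top boundary and `v = 2n` the bottom boundary, and column
`c : Fin L`, 0-indexed right to left). -/
abbrev St (n L : ℕ) := (Fin (2*n) × Fin (L+1) → Col n) × (Fin (2*n+1) × Fin L → Vec n)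

/-- The vector assigned at the top of column `c` (the paper's column `c+1`):
`∑_{i=1}^n (1_{μ_i = c+1} e_i + 1_{μ_i = -(c+1)} e_{ī})`. -/
def topV (n L : ℕ) (μ : Fin n → ℤ) (c : Fin L) : Vec n := fun k =>
  ∑ i : Fin n,
    ((if μ i = (c.val : ℤ) + 1 ∧ k = posC n i then 1 else 0) +
     (if μ i = -((c.val : ℤ) + 1) ∧ k = barC n (posC n i) then 1 else 0))

/-- The boundary conditions of the model with data `(σ, μ)`: on the left, the
paper's row `2i-1` (a Δ row, 0-indexed row `2i-2`, even) carries the color `0`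
and the paper's row `2i` (a Γ row, 0-indexed row `2i-1`, odd) carries the color
`σ(i)`; at the bottom every vertical edge carries the zero vector; at the top
the vertical edge in column `c` carries `topV μ c`. -/
def BC (n L : ℕ) (σ : Equiv.Perm (Col n)) (μ : Fin n → ℤ) (st : St n L) : Prop :=
  (∀ r : Fin (2*n), st.1 (r, Fin.last L) =
      if r.val % 2 = 0 then mid n
      else σ (posC n ⟨r.val / 2, by have := r.isLt; omega⟩)) ∧
  (∀ c : Fin L, st.2 (0, c) = topV n L μ c) ∧
  (∀ c : Fin L, st.2 (Fin.last (2*n), c) = fun _ => 0)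

/-- The Boltzmann weight of a state: the product of the weights of all the
Γ, Δ and cap vertices.  Even 0-indexed rows (the paper's odd rows `2i-1`) are
rows of Δ vertices and odd 0-indexed rows (the paper's even rows `2i`) are rows
of Γ vertices, both with spectral parameter `x i`; the cap with spectral
parameter `x i` joins the right end of the paper's row `2i` (incoming, bottom)
to the right end of the paper's row `2i-1` (outgoing, top).
Here `qh` denotes the fixed branch of `q^{-1/2}`. -/
noncomputable def stWt (n L : ℕ) (q s ν t qh : ℂ) (x : Fin n → ℂ) (st : St n L) : ℂ :=
  (∏ r : Fin (2*n), ∏ c : Fin L,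
    if r.val % 2 = 0 then
      MW n q s (x ⟨r.val / 2, by have := r.isLt; omega⟩)
        (st.2 (r.succ, c)) (st.1 (r, c.castSucc)) (st.2 (r.castSucc, c)) (st.1 (r, c.succ))
    else
      LW n q s (x ⟨r.val / 2, by have := r.isLt; omega⟩)
        (st.2 (r.succ, c)) (st.1 (r, c.succ)) (st.2 (r.castSucc, c)) (st.1 (r, c.castSucc)))
  * ∏ i : Fin n,
      capW n ν t qh (x i)
        (st.1 (⟨2 * i.val + 1, by have := i.isLt; omega⟩, 0))
        (st.1 (⟨2 * i.val, by have := i.isLt; omega⟩, 0))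

/-- The partition function `f_μ^σ(x)` of the colored stochastic vertex model
with U-turn boundary: the sum of the Boltzmann weights of all states satisfying
the boundary conditions (the weight of a non-admissible state is `0`, and only
finitely many states have nonzero weight, so this is a finite sum over the
admissible states). -/
noncomputable def pf (n L : ℕ) (q s ν t qh : ℂ) (x : Fin n → ℂ)
    (σ : Equiv.Perm (Col n)) (μ : Fin n → ℤ) : ℂ :=
  ∑ᶠ st ∈ {st : St n L | BC n L σ μ st}, stWt n L q s ν t qh x st

/-- The element `s_i ∈ B_n` (for paper indices `i, i+1`, here 0-indexed `i, i'`
with `i' = i+1`), viewed as the permutation of the colors swapping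
`i ↔ i+1` and `ī ↔ \overline{i+1}`. -/
def siB (n : ℕ) (i i' : Fin n) : Equiv.Perm (Col n) :=
  (Equiv.swap (posC n i) (posC n i')).trans
    (Equiv.swap (barC n (posC n i)) (barC n (posC n i')))

/-- The color `n` (the paper's largest positive color). -/
def lastCol (n : ℕ) : Col n := ⟨n - 1, by omega⟩

/-- The element `s_n ∈ B_n` with `s_n(n) = n̄` and `s_n(j) = j` for `j < n`,
viewed as the permutation of the colors swapping `n ↔ n̄`. -/
def snB (n : ℕ) : Equiv.Perm (Col n) :=
  Equiv.swap (lastCol n) (barC n (lastCol n))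

/-- The Coxeter generating set `{s_1, …, s_{n-1}, s_n}` of `B_n`, viewed as
permutations of the colors. -/
def gensB (n : ℕ) : Set (Equiv.Perm (Col n)) :=
  {g | (∃ i i' : Fin n, (i' : ℕ) = (i : ℕ) + 1 ∧ g = siB n i i') ∨ g = snB n}

/-- The length function `l(σ)` on `B_n` with respect to the Coxeter generators
`s_1, …, s_n`: the minimal length of a word in the generators expressing `σ`. -/
noncomputable def lenB (n : ℕ) (σ : Equiv.Perm (Col n)) : ℕ :=
  sInf {m : ℕ | ∃ w : List (Equiv.Perm (Col n)),
    w.length = m ∧ (∀ g ∈ w, g ∈ gensB n) ∧ w.prod = σ}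

/-- The normalized partition function `F_μ^σ(x)`, where `r j` is the fixed
choice of the square root `√((x_j² - q)/(1 - q x_j²))` and `qh` is the fixed
branch of `q^{-1/2}`. -/
noncomputable def Fnorm (n L : ℕ) (q s ν t qh : ℂ) (x r : Fin n → ℂ)
    (σ : Equiv.Perm (Col n)) (μ : Fin n → ℤ) : ℂ :=
  q ^ (lenB n σ + ∑ j : Fin n, (n - 1 - j.val) * (if σ (posC n j) < mid n then 1 else 0))
    * s ^ (-(2 * (L : ℤ) * (∑ j : Fin n, if mid n < σ (posC n j) then (1 : ℤ) else 0)))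
    * (t / q) ^ (∑ j : Fin n, if mid n < σ (posC n j) then 1 else 0)
    * (∏ j : Fin n, ((1 - s * x j) / (s - x j)) ^ L)
    * (∏ j : Fin n, r j)
    * pf n L q s ν t qh x σ μ


/-- Piecewise scaled cut function for `Γ` weights. -/
noncomputable def gG (z : ℂ) (P : ℕ → ℂ) (j k : ℕ) : ℂ := if k ≤ j then P k else z * P k

/-- Numerator of the `Γ` weight in terms of the cut function `P`. -/
noncomputable def ellN (z : ℂ) (P : ℕ → ℂ) (j l : ℕ) : ℂ := gG z P j l - gG z P j (l+1)

/-- Piecewise scaled cut function for `Δ` weights. -/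
noncomputable def hH (w : ℂ) (P : ℕ → ℂ) (j k : ℕ) : ℂ := if k ≤ j then w * (P k)⁻¹ else (P k)⁻¹

/-- Numerator of the `Δ` weight in terms of the cut function `P`. -/
noncomputable def emN (w : ℂ) (P : ℕ → ℂ) (j l : ℕ) : ℂ := hH w P j (l+1) - hH w P j l

/-- Update of the cut function when color `a` enters and color `l` leaves. -/
noncomputable def shP (q : ℂ) (P : ℕ → ℂ) (a l k : ℕ) : ℂ :=
  P k * (if l < k then q else 1) * (if a < k then q⁻¹ else 1)

/-- Non-crossing weight of the R-matrix. -/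
noncomputable def rF (q u v : ℂ) (a b : ℕ) : ℂ :=
  if a = b then u - q * v else if a < b then q * (u - v) else u - v

/-- Color exchanging weight of the R-matrix. -/
noncomputable def rG (q u v : ℂ) (a b : ℕ) : ℂ :=
  if a = b then 0 else if a < b then (1 - q) * u else (1 - q) * v

set_option maxHeartbeats 4000000 in
theorem ybe_coeff (q z w : ℂ) (hq : q ≠ 0) (P : ℕ → ℂ) (a b c d : ℕ) :
    rF q z w a b * (ellN z P a c * ellN w (shP q P a c) b d)
      + rG q z w a b * (ellN z P b c * ellN w (shP q P b c) a d)
    = ellN w P b d * ellN z (shP q P b d) a c * rF q z w c d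
      + ellN w P b c * ellN z (shP q P b c) a d * rG q z w d c := by
  unfold ellN gG shP rF rG
  rcases lt_trichotomy a b with h1 | h1 | h1 <;> rcases lt_trichotomy c d with h2 | h2 | h2 <;>
  rcases lt_trichotomy a c with h3 | h3 | h3 <;> rcases lt_trichotomy a d with h4 | h4 | h4 <;>
  first
  | (exfalso; omega)
  | (rcases lt_trichotomy b c with h5 | h5 | h5 <;> rcases lt_trichotomy b d with h6 | h6 | h6 <;>
     first
     | (exfalso; omega)
     | (simp (disch := omega) only [if_pos, if_neg]
        try subst h1
        try subst h2
        try subst h3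
        try subst h4
        try subst h5
        try subst h6
        field_simp
        try ring))

theorem sum_piece (N : ℕ) (G : ℕ → ℂ) (j : ℕ) (hj : j < N) (A B C : ℂ) :
    ∑ l : Fin N, (G (l.val+1) - G l.val) * (if l.val < j then A else if l.val = j then B else C)
     = (G j - G 0) * A + (G (j+1) - G j) * B + (G N - G (j+1)) * C := by
  rw [Fin.sum_univ_eq_sum_range (fun l => (G (l+1) - G l) * (if l < j then A else if l = j then B else C)) N]
  obtain ⟨m, rfl⟩ : ∃ m, N = j + 1 + m := ⟨N - (j+1), by omega⟩
  rw [Finset.sum_range_add, Finset.sum_range_succ]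
  have e1 : ∑ l ∈ Finset.range j, (G (l+1) - G l) * (if l < j then A else if l = j then B else C)
      = (G j - G 0) * A := by
    rw [← Finset.sum_range_sub, Finset.sum_mul]
    refine Finset.sum_congr rfl fun l hl => ?_
    rw [if_pos (Finset.mem_range.1 hl)]
  have e2 : ∑ l ∈ Finset.range m, (G (j+1+l+1) - G (j+1+l)) * (if j+1+l < j then A else if j+1+l = j then B else C)
      = (G (j+1+m) - G (j+1)) * C := by
    have := Finset.sum_range_sub (fun l => G (j+1+l)) m
    simp only [add_zero] at this
    rw [← this, Finset.sum_mul]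
    refine Finset.sum_congr rfl fun l hl => ?_
    rw [if_neg (by omega), if_neg (by omega)]
    rfl
  rw [e1, e2]
  simp


/-- first inversion relation -/
theorem inv_coeff1 (N : ℕ) (q z w S : ℂ) (hq : q ≠ 0) (hzw : q * S * z * w = 1) (P : ℕ → ℂ)
    (hP : ∀ k, P k ≠ 0) (h0 : P 0 = 1) (hN : P N = S) (a j : ℕ) (ha : a < N) (hj : j < N) :
    ∑ l : Fin N, ellN z P a l * emN w (shP q P a l) l j
      = if a = j then (1 - z * S) * (S⁻¹ - w) else 0 := by
  have hS : S ≠ 0 := hN ▸ hP N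
  have hw : w ≠ 0 := by rintro rfl; simp at hzw
  have hz : z = (q * S * w)⁻¹ := by field_simp; linear_combination hzw
  have hPj := hP j
  have hPj1 := hP (j+1)
  have key : ∀ l : Fin N, ellN z P a l * emN w (shP q P a l) l j =
     ((- gG z P a (l.val+1)) - (- gG z P a l.val)) *
      (if l.val < j then q⁻¹ * ((P (j+1))⁻¹ * (if a < j+1 then q else 1) - (P j)⁻¹ * (if a < j then q else 1))
        else if l.val = j then q⁻¹ * ((P (j+1))⁻¹ * (if a < j+1 then q else 1)) - w * ((P j)⁻¹ * (if a < j then q else 1))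
        else w * ((P (j+1))⁻¹ * (if a < j+1 then q else 1) - (P j)⁻¹ * (if a < j then q else 1))) := by
    intro l
    have e1 : ellN z P a l = ((- gG z P a (l.val+1)) - (- gG z P a l.val)) := by
      unfold ellN; ring
    rw [e1]
    congr 1
    unfold emN hH shP
    rcases lt_trichotomy l.val j with h | h | h <;> rcases lt_trichotomy a j with h' | h' | h' <;>
      simp (disch := omega) only [if_pos, if_neg] <;> field_simp
  rw [Finset.sum_congr rfl (fun l _ => key l), sum_piece N (fun k => - gG z P a k) j hj]
  unfold gG
  rcases lt_trichotomy a j with h' | h' | h' <;>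
      simp (disch := omega) only [if_pos, if_neg, h0, hN] <;> rw [hz] <;> field_simp <;> ring

/-- second inversion relation -/
theorem inv_coeff2 (N : ℕ) (q z w S : ℂ) (hq : q ≠ 0) (hzw : q * S * z * w = 1) (P : ℕ → ℂ)
    (hP : ∀ k, P k ≠ 0) (h0 : P 0 = 1) (hN : P N = S) (a j : ℕ) (ha : a < N) (hj : j < N) :
    ∑ l : Fin N, emN w P a l * ellN z (shP q P a l) l j
      = if a = j then (1 - z * S) * (S⁻¹ - w) else 0 := by
  have hS : S ≠ 0 := hN ▸ hP N
  have hw : w ≠ 0 := by rintro rfl; simp at hzw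
  have hz : z = (q * S * w)⁻¹ := by field_simp; linear_combination hzw
  have hPj := hP j
  have hPj1 := hP (j+1)
  have key : ∀ l : Fin N, emN w P a l * ellN z (shP q P a l) l j =
     (hH w P a (l.val+1) - hH w P a l.val) *
      (if l.val < j then z * q * (P j * (if a < j then q⁻¹ else 1) - P (j+1) * (if a < j+1 then q⁻¹ else 1))
        else if l.val = j then P j * (if a < j then q⁻¹ else 1) - z * q * (P (j+1) * (if a < j+1 then q⁻¹ else 1))
        else P j * (if a < j then q⁻¹ else 1) - P (j+1) * (if a < j+1 then q⁻¹ else 1)) := by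
    intro l
    have e1 : emN w P a l = (hH w P a (l.val+1) - hH w P a l.val) := rfl
    rw [e1]
    congr 1
    unfold ellN gG shP
    rcases lt_trichotomy l.val j with h | h | h <;> rcases lt_trichotomy a j with h' | h' | h' <;>
      simp (disch := omega) only [if_pos, if_neg] <;> field_simp
  rw [Finset.sum_congr rfl (fun l _ => key l), sum_piece N (fun k => hH w P a k) j hj]
  unfold hH
  rcases lt_trichotomy a j with h' | h' | h' <;>
      simp (disch := omega) only [if_pos, if_neg, h0, hN] <;> rw [hz] <;> field_simp <;> ring

/-- flip probability of the cap -/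
noncomputable def kap (n : ℕ) (t p : ℂ) (a : ℕ) : ℂ := if a < n then t * p else if n < a then p else 0

section RE
variable (q t : ℂ) (n : ℕ) 
noncomputable def k1f (p : ℂ) (F : ℕ → ℕ → ℂ) (a b : ℕ) : ℂ :=
  kap n t p a * F (2 * n - a) b + (1 - kap n t p a) * F a b
noncomputable def k2f (p : ℂ) (F : ℕ → ℕ → ℂ) (a b : ℕ) : ℂ :=
  kap n t p b * F a (2 * n - b) + (1 - kap n t p b) * F a b
noncomputable def r12f (u v : ℂ) (F : ℕ → ℕ → ℂ) (a b : ℕ) : ℂ :=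
  rF q u v a b * F a b + rG q u v a b * F b a
noncomputable def r21f (u v : ℂ) (F : ℕ → ℕ → ℂ) (a b : ℕ) : ℂ :=
  rF q u v b a * F a b + rG q u v b a * F b a
end RE

set_option maxHeartbeats 4000000 in
theorem refl_eq (q t x y γ dx dy : ℂ) (n : ℕ) (hdx : dx = q * x^2 + γ * x - t) (hdy : dy = q * y^2 + γ * y - t)
    (hdx0 : dx ≠ 0) (hdy0 : dy ≠ 0)
    (F : ℕ → ℕ → ℂ) (a b a' b' : ℕ) (ha : a + a' = 2 * n) (hb : b + b' = 2 * n) :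
    r12f q x y (k1f t n ((q*x^2-1)/dx) (r21f q (q*x*y) 1 (k2f t n ((q*y^2-1)/dy) F))) a b
     = k2f t n ((q*y^2-1)/dy) (r12f q (q*x*y) 1 (k1f t n ((q*x^2-1)/dx) (r21f q x y F))) a b := by
  unfold r12f k1f r21f k2f rF rG kap
  have e1 : 2 * n - a = a' := by omega
  have e2 : 2 * n - b = b' := by omega
  have e3 : 2 * n - a' = a := by omega
  have e4 : 2 * n - b' = b := by omega
  simp only [e1, e2, e3, e4]
  rcases lt_trichotomy a n with h1 | h1 | h1 <;> rcases lt_trichotomy b n with h2 | h2 | h2 <;>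
  rcases lt_trichotomy a b with h3 | h3 | h3 <;> rcases lt_trichotomy a b' with h4 | h4 | h4 <;>
  first
  | (exfalso; omega)
  | (simp (disch := omega) only [if_pos, if_neg]
     first
     | (have hh : b = a := by omega
        subst hh
        have hh : b' = b := by omega
        subst hh
        have hh : a' = b' := by omega
        subst hh
        field_simp
        try (rw [hdx, hdy])
        try ring)
     | (have hh : b = a := by omega
        subst hh
        have hh : a' = b' := by omega
        subst hh
        field_simp
        try (rw [hdx, hdy])
        try ring)
     | (have hh : b = a' := by omega
        subst hh
        have hh : a = b' := by omega
        subst hh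
        field_simp
        try (rw [hdx, hdy])
        try ring)
     | (have hh : a = a' := by omega
        subst hh
        field_simp
        try (rw [hdx, hdy])
        try ring)
     | (have hh : b = b' := by omega
        subst hh
        field_simp
        try (rw [hdx, hdy])
        try ring)
     | (field_simp
        try (rw [hdx, hdy])
        try ring))


/-- Integer vertical configurations, one integer vector for each column. -/
abbrev Idx (n : ℕ) := ℕ → Col n → ℤ

/-- Integer version of `eV`. -/
def eZ (n : ℕ) (c : Col n) : Col n → ℤ := fun k => if c ≠ mid n ∧ k = c then 1 else 0

/-- Change of the vertical configuration in column `c`. -/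
def incr (n : ℕ) (c : ℕ) (a l : Col n) : Idx n := fun c' => if c' = c then eZ n a - eZ n l else 0

/-- The cut function of an integer vector. -/
noncomputable def Pk (n : ℕ) (q s : ℂ) (I : Col n → ℤ) (k : ℕ) : ℂ :=
  if k ≤ n then q ^ (-(∑ c ∈ Finset.univ.filter (fun c : Col n => c.val < k), I c))
  else s ^ 2 * q ^ (∑ c ∈ Finset.univ.filter (fun c : Col n => k ≤ c.val), I c)

theorem Pk_ne (n : ℕ) (q s : ℂ) (hq : q ≠ 0) (hs : s ≠ 0) (I : Col n → ℤ) (k : ℕ) :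
    Pk n q s I k ≠ 0 := by
  unfold Pk
  split_ifs
  · exact zpow_ne_zero _ hq
  · exact mul_ne_zero (pow_ne_zero _ hs) (zpow_ne_zero _ hq)

theorem Pk_zero (n : ℕ) (q s : ℂ) (I : Col n → ℤ) : Pk n q s I 0 = 1 := by
  simp [Pk]

theorem Pk_last (n : ℕ) (q s : ℂ) (I : Col n → ℤ) : Pk n q s I (2*n+1) = s^2 := by
  unfold Pk
  rw [if_neg (by omega), Finset.filter_false_of_mem]
  · simp
  · intro c _
    have := c.isLt
    omega

theorem eZ_sum_lt (n : ℕ) (a : Col n) (k : ℕ) (hk : k ≤ n) :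
    ∑ c ∈ Finset.univ.filter (fun c : Col n => c.val < k), eZ n a c = if a.val < k then 1 else 0 := by
  unfold eZ
  by_cases h : a.val < k
  · have ham : a ≠ mid n := by intro h'; rw [h'] at h; simp [mid] at h; omega
    simp [ham, h]
  · rw [if_neg h]
    apply Finset.sum_eq_zero
    intro c hc
    simp only [Finset.mem_filter, Finset.mem_univ, true_and] at hc
    rw [if_neg]
    rintro ⟨_, rfl⟩
    exact h hc

theorem eZ_sum_ge (n : ℕ) (a : Col n) (k : ℕ) (hk : ¬ k ≤ n) :
    ∑ c ∈ Finset.univ.filter (fun c : Col n => k ≤ c.val), eZ n a c = if a.val < k then 0 else 1 := by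
  unfold eZ
  by_cases h : a.val < k
  · rw [if_pos h]
    apply Finset.sum_eq_zero
    intro c hc
    simp only [Finset.mem_filter, Finset.mem_univ, true_and] at hc
    rw [if_neg]
    rintro ⟨_, rfl⟩
    omega
  · have ham : a ≠ mid n := by intro h'; rw [h'] at h; simp [mid] at h; omega
    simp [ham, h, not_lt.1 h]

theorem Pk_shift (n : ℕ) (q s : ℂ) (hq : q ≠ 0) (I : Col n → ℤ) (a l : Col n) :
    Pk n q s (I + (eZ n a - eZ n l)) = shP q (Pk n q s I) a l := by
  funext k
  unfold Pk shP
  by_cases hk : k ≤ n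
  · simp only [if_pos hk, Pi.add_apply, Pi.sub_apply, Finset.sum_add_distrib, Finset.sum_sub_distrib,
      eZ_sum_lt n _ k hk]
    split_ifs <;> simp [zpow_add₀ hq, zpow_sub₀ hq, neg_add] <;> field_simp
  · simp only [if_neg hk, Pi.add_apply, Pi.sub_apply, Finset.sum_add_distrib, Finset.sum_sub_distrib,
      eZ_sum_ge n _ k hk]
    split_ifs <;> simp [zpow_add₀ hq, zpow_sub₀ hq, neg_add] <;> field_simp

/-- One-line function space. -/
abbrev V1 (n : ℕ) := Col n → Idx n → ℂ
/-- Two-line function space. -/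
abbrev V2 (n : ℕ) := Col n → Col n → Idx n → ℂ

/-- `Γ` vertex operator in column `c`. -/
noncomputable def opL (n : ℕ) (q s z : ℂ) (c : ℕ) : Module.End ℂ (V1 n) where
  toFun φ := fun a I => ∑ l : Col n, ellN z (Pk n q s (I c)) a l * φ l (I + incr n c a l)
  map_add' φ ψ := by
    funext a I
    simp [mul_add, Finset.sum_add_distrib]
  map_smul' r φ := by
    funext a I
    simp [Finset.mul_sum, mul_left_comm]

/-- `Δ` vertex operator in column `c`. -/
noncomputable def opM (n : ℕ) (q s w : ℂ) (c : ℕ) : Module.End ℂ (V1 n) where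
  toFun φ := fun a I => ∑ l : Col n, emN w (Pk n q s (I c)) a l * φ l (I + incr n c a l)
  map_add' φ ψ := by
    funext a I
    simp [mul_add, Finset.sum_add_distrib]
  map_smul' r φ := by
    funext a I
    simp [Finset.mul_sum, mul_left_comm]

/-- Cap operator. -/
noncomputable def opK (n : ℕ) (t p : ℂ) : Module.End ℂ (V1 n) where
  toFun φ := fun a I => kap n t p a * φ (barC n a) I + (1 - kap n t p a) * φ a I
  map_add' φ ψ := by
    funext a I
    simp; ring
  map_smul' r φ := by
    funext a I
    simp; ring

/-- Act on the first color. -/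
noncomputable def lift1 (n : ℕ) (X : Module.End ℂ (V1 n)) : Module.End ℂ (V2 n) where
  toFun Φ := fun a b I => X (fun c J => Φ c b J) a I
  map_add' Φ Ψ := by
    funext a b I
    have : (fun c J => (Φ + Ψ) c b J) = (fun c J => Φ c b J) + (fun c J => Ψ c b J) := rfl
    simp only [this, map_add]; rfl
  map_smul' r Φ := by
    funext a b I
    have : (fun c J => (r • Φ) c b J) = r • (fun c J => Φ c b J) := rfl
    simp only [this, map_smul]; rfl

/-- Exchange the two colors. -/
def opS (n : ℕ) : Module.End ℂ (V2 n) where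
  toFun Φ := fun a b I => Φ b a I
  map_add' Φ Ψ := rfl
  map_smul' r Φ := rfl

/-- Act on the second color. -/
noncomputable def lift2 (n : ℕ) (X : Module.End ℂ (V1 n)) : Module.End ℂ (V2 n) where
  toFun Φ := fun a b I => X (fun c J => Φ a c J) b I
  map_add' Φ Ψ := by
    funext a b I
    have : (fun c J => (Φ + Ψ) a c J) = (fun c J => Φ a c J) + (fun c J => Ψ a c J) := rfl
    simp only [this, map_add]; rfl
  map_smul' r Φ := by
    funext a b I
    have : (fun c J => (r • Φ) a c J) = r • (fun c J => Φ a c J) := rfl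
    simp only [this, map_smul]; rfl

/-- R-matrix. -/
noncomputable def opR (n : ℕ) (q u v : ℂ) : Module.End ℂ (V2 n) where
  toFun Φ := fun a b I => rF q u v a b * Φ a b I + rG q u v a b * Φ b a I
  map_add' Φ Ψ := by
    funext a b I
    simp; ring
  map_smul' r Φ := by
    funext a b I
    simp; ring

/-- R-matrix, with exchanged tensor factors. -/
noncomputable def opR' (n : ℕ) (q u v : ℂ) : Module.End ℂ (V2 n) where
  toFun Φ := fun a b I => rF q u v b a * Φ a b I + rG q u v b a * Φ b a I
  map_add' Φ Ψ := by
    funext a b I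
    simp; ring
  map_smul' r Φ := by
    funext a b I
    simp; ring

section ops
variable {n : ℕ}

theorem lift1_mul (X Y : Module.End ℂ (V1 n)) : lift1 n (X * Y) = lift1 n X * lift1 n Y := rfl
theorem lift2_mul (X Y : Module.End ℂ (V1 n)) : lift2 n (X * Y) = lift2 n X * lift2 n Y := rfl
theorem lift1_one : lift1 n 1 = 1 := rfl
theorem lift2_one : lift2 n 1 = 1 := rfl
theorem lift1_smul (r : ℂ) (X : Module.End ℂ (V1 n)) : lift1 n (r • X) = r • lift1 n X := rfl
theorem lift2_smul (r : ℂ) (X : Module.End ℂ (V1 n)) : lift2 n (r • X) = r • lift2 n X := rfl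
theorem opS_opS : opS n * opS n = 1 := rfl
theorem opS_lift1 (X : Module.End ℂ (V1 n)) : opS n * lift1 n X = lift2 n X * opS n := rfl
theorem opS_lift2 (X : Module.End ℂ (V1 n)) : opS n * lift2 n X = lift1 n X * opS n := rfl
theorem opS_opR (q u v : ℂ) : opS n * opR n q u v = opR' n q u v * opS n := rfl
theorem opS_opR' (q u v : ℂ) : opS n * opR' n q u v = opR n q u v * opS n := rfl
theorem opR_smul (q r u v : ℂ) : opR n q (r * u) (r * v) = r • opR n q u v := by
  refine LinearMap.ext fun Φ => ?_
  funext a b I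
  simp only [opR, LinearMap.coe_mk, AddHom.coe_mk, LinearMap.smul_apply, Pi.smul_apply, smul_eq_mul, rF, rG]
  split_ifs <;> ring

theorem lift_comm_K1 (t p : ℂ) (X : Module.End ℂ (V1 n)) :
    lift1 n (opK n t p) * lift2 n X = lift2 n X * lift1 n (opK n t p) := by
  refine LinearMap.ext fun Φ => ?_
  funext a b I
  have : (fun c J => (lift1 n (opK n t p) Φ) a c J) = kap n t p a • (fun c J => Φ (barC n a) c J)
      + (1 - kap n t p a) • (fun c J => Φ a c J) := rfl
  change _ = X (fun c J => (lift1 n (opK n t p) Φ) a c J) b I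
  rw [this, map_add, map_smul, map_smul]
  rfl

theorem lift_comm_K2 (t p : ℂ) (X : Module.End ℂ (V1 n)) :
    lift2 n (opK n t p) * lift1 n X = lift1 n X * lift2 n (opK n t p) := by
  have h := congrArg (fun Y => opS n * Y * opS n) (lift_comm_K1 t p X)
  exact h

theorem incr_same (c : ℕ) (a l : Col n) (I : Idx n) : (I + incr n c a l) c = I c + (eZ n a - eZ n l) := by
  simp [incr]

theorem incr_other (c c' : ℕ) (h : c' ≠ c) (a l : Col n) (I : Idx n) : (I + incr n c a l) c' = I c' := by
  simp [incr, h]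

theorem incr_comp (c : ℕ) (a b l : Col n) (I : Idx n) :
    I + incr n c a l + incr n c l b = I + incr n c a b := by
  funext c'
  by_cases h : c' = c
  · simp only [incr, h, Pi.add_apply, if_true]; abel
  · simp [incr, h]

theorem incr_self (c : ℕ) (a : Col n) (I : Idx n) : I + incr n c a a = I := by
  funext c'
  by_cases h : c' = c <;> simp [incr, h]

theorem incr_exch (c : ℕ) (a b l m : Col n) (I : Idx n) :
    I + incr n c a l + incr n c b m = I + incr n c b l + incr n c a m := by
  funext c'
  by_cases h : c' = c
  · simp [incr, h]; abel
  · simp [incr, h]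

theorem ybe_loc (q s z w : ℂ) (hq : q ≠ 0) (c : ℕ) :
    opR n q z w * (lift1 n (opL n q s z c) * lift2 n (opL n q s w c))
      = (lift2 n (opL n q s w c) * lift1 n (opL n q s z c)) * opR n q z w := by
  refine LinearMap.ext fun Φ => ?_
  funext a b I
  change rF q z w a b * ∑ l : Col n, ellN z (Pk n q s (I c)) a l *
        ∑ m : Col n, ellN w (Pk n q s ((I + incr n c a l) c)) b m * Φ l m (I + incr n c a l + incr n c b m)
      + rG q z w a b * ∑ l : Col n, ellN z (Pk n q s (I c)) b l *
        ∑ m : Col n, ellN w (Pk n q s ((I + incr n c b l) c)) a m * Φ l m (I + incr n c b l + incr n c a m)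
    = ∑ m : Col n, ellN w (Pk n q s (I c)) b m * ∑ l : Col n, ellN z (Pk n q s ((I + incr n c b m) c)) a l *
        (rF q z w l m * Φ l m (I + incr n c b m + incr n c a l)
          + rG q z w l m * Φ m l (I + incr n c b m + incr n c a l))
  simp only [incr_same, Pk_shift n q s hq]
  set P := Pk n q s (I c)
  have hR : ∑ m : Col n, ellN w P b m * ∑ l : Col n, ellN z (shP q P b m) a l *
        (rF q z w l m * Φ l m (I + incr n c b m + incr n c a l)
          + rG q z w l m * Φ m l (I + incr n c b m + incr n c a l))
      = ∑ l : Col n, ∑ m : Col n, (ellN w P b m * ellN z (shP q P b m) a l * rF q z w l m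
          + ellN w P b l * ellN z (shP q P b l) a m * rG q z w m l) *
            Φ l m (I + incr n c a l + incr n c b m) := by
    have e1 : ∀ m l : Col n, ellN w P b m * (ellN z (shP q P b m) a l *
        (rF q z w l m * Φ l m (I + incr n c b m + incr n c a l)
          + rG q z w l m * Φ m l (I + incr n c b m + incr n c a l)))
        = ellN w P b m * ellN z (shP q P b m) a l * rF q z w l m * Φ l m (I + incr n c a l + incr n c b m)
          + ellN w P b m * ellN z (shP q P b m) a l * rG q z w l m * Φ m l (I + incr n c a m + incr n c b l) := by
      intro m l
      rw [show I + incr n c b m + incr n c a l = I + incr n c a l + incr n c b m by abel,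
        incr_exch c a b l m]
      rw [show I + incr n c b l + incr n c a m = I + incr n c a m + incr n c b l by abel]
      ring
    simp only [Finset.mul_sum, e1, Finset.sum_add_distrib, add_mul]
    rw [Finset.sum_comm]
  rw [hR]
  simp only [Finset.mul_sum]
  rw [← Finset.sum_add_distrib]
  refine Finset.sum_congr rfl fun l _ => ?_
  rw [← Finset.sum_add_distrib]
  refine Finset.sum_congr rfl fun m _ => ?_
  rw [← ybe_coeff q z w hq P a b l m, ← incr_exch c a b l m]
  ring

theorem comm_loc (q s z w : ℂ) (c c' : ℕ) (h : c ≠ c') :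
    lift1 n (opL n q s z c) * lift2 n (opL n q s w c')
      = lift2 n (opL n q s w c') * lift1 n (opL n q s z c) := by
  refine LinearMap.ext fun Φ => ?_
  funext a b I
  change ∑ l : Col n, ellN z (Pk n q s (I c)) a l *
        ∑ m : Col n, ellN w (Pk n q s ((I + incr n c a l) c')) b m * Φ l m (I + incr n c a l + incr n c' b m)
    = ∑ m : Col n, ellN w (Pk n q s (I c')) b m *
        ∑ l : Col n, ellN z (Pk n q s ((I + incr n c' b m) c)) a l * Φ l m (I + incr n c' b m + incr n c a l)
  simp only [incr_other c c' h.symm, incr_other c' c h, Finset.mul_sum]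
  rw [Finset.sum_comm]
  refine Finset.sum_congr rfl fun m _ => Finset.sum_congr rfl fun l _ => ?_
  rw [show I + incr n c' b m + incr n c a l = I + incr n c a l + incr n c' b m by abel]
  ring

theorem inv_loc1 (q s z w : ℂ) (hq : q ≠ 0) (hs : s ≠ 0) (hzw : q * s^2 * z * w = 1) (c : ℕ) :
    opL n q s z c * opM n q s w c = ((1 - z * s^2) * ((s^2)⁻¹ - w)) • (1 : Module.End ℂ (V1 n)) := by
  refine LinearMap.ext fun φ => ?_
  funext a I
  change ∑ l : Col n, ellN z (Pk n q s (I c)) a l *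
        ∑ m : Col n, emN w (Pk n q s ((I + incr n c a l) c)) l m * φ m (I + incr n c a l + incr n c l m)
    = ((1 - z * s^2) * ((s^2)⁻¹ - w)) * φ a I
  simp only [incr_same, Pk_shift n q s hq, incr_comp, Finset.mul_sum]
  rw [Finset.sum_comm]
  simp only [← mul_assoc, ← Finset.sum_mul]
  rw [Finset.sum_congr rfl fun m _ => by
    rw [inv_coeff1 (2*n+1) q z w (s^2) hq hzw (Pk n q s (I c)) (Pk_ne n q s hq hs _) (Pk_zero n q s _)
      (Pk_last n q s _) a m a.isLt m.isLt]]
  rw [Finset.sum_eq_single a]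
  · simp [incr_self]
  · intro m _ hm
    rw [if_neg (fun h => hm (Fin.ext h.symm)), zero_mul]
  · simp

theorem inv_loc2 (q s z w : ℂ) (hq : q ≠ 0) (hs : s ≠ 0) (hzw : q * s^2 * z * w = 1) (c : ℕ) :
    opM n q s w c * opL n q s z c = ((1 - z * s^2) * ((s^2)⁻¹ - w)) • (1 : Module.End ℂ (V1 n)) := by
  refine LinearMap.ext fun φ => ?_
  funext a I
  change ∑ l : Col n, emN w (Pk n q s (I c)) a l *
        ∑ m : Col n, ellN z (Pk n q s ((I + incr n c a l) c)) l m * φ m (I + incr n c a l + incr n c l m)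
    = ((1 - z * s^2) * ((s^2)⁻¹ - w)) * φ a I
  simp only [incr_same, Pk_shift n q s hq, incr_comp, Finset.mul_sum]
  rw [Finset.sum_comm]
  simp only [← mul_assoc, ← Finset.sum_mul]
  rw [Finset.sum_congr rfl fun m _ => by
    rw [inv_coeff2 (2*n+1) q z w (s^2) hq hzw (Pk n q s (I c)) (Pk_ne n q s hq hs _) (Pk_zero n q s _)
      (Pk_last n q s _) a m a.isLt m.isLt]]
  rw [Finset.sum_eq_single a]
  · simp [incr_self]
  · intro m _ hm
    rw [if_neg (fun h => hm (Fin.ext h.symm)), zero_mul]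
  · simp

end ops


section mono
variable {n : ℕ}

/-- Natural number to color. -/
def cl (n k : ℕ) : Col n := if h : k < 2 * n + 1 then ⟨k, h⟩ else mid n

theorem cl_val (a : Col n) : cl n a.val = a := by
  simp only [cl]
  rw [dif_pos a.isLt]

theorem cl_bar (a : Col n) : cl n (2 * n - a.val) = barC n a := by
  have := a.isLt
  simp only [cl, barC]
  rw [dif_pos (by omega)]

theorem bar_val (a : Col n) : (barC n a).val = 2 * n - a.val := rfl

theorem bar_bar (a : Col n) : barC n (barC n a) = a := by
  have := a.isLt
  apply Fin.ext
  simp only [bar_val]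
  omega

theorem sub_sub_col (a : Col n) : 2 * n - (2 * n - a.val) = a.val := by
  have := a.isLt
  omega

theorem refl_op (q t x y γ dx dy : ℂ) (hdx : dx = q * x^2 + γ * x - t) (hdy : dy = q * y^2 + γ * y - t)
    (hdx0 : dx ≠ 0) (hdy0 : dy ≠ 0) :
    opR n q x y * lift1 n (opK n t ((q*x^2-1)/dx)) * opR' n q (q*x*y) 1 * lift2 n (opK n t ((q*y^2-1)/dy))
     = lift2 n (opK n t ((q*y^2-1)/dy)) * opR n q (q*x*y) 1 * lift1 n (opK n t ((q*x^2-1)/dx))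
        * opR' n q x y := by
  refine LinearMap.ext fun Φ => ?_
  funext a b I
  have h := refl_eq q t x y γ dx dy n hdx hdy hdx0 hdy0 (fun i j => Φ (cl n i) (cl n j) I) a b
    (2 * n - a.val) (2 * n - b.val) (by have := a.isLt; omega) (by have := b.isLt; omega)
  simp only [r12f, k1f, r21f, k2f, cl_val, cl_bar, sub_sub_col] at h
  simp only [Module.End.mul_apply]
  simp only [opR, opR', lift1, lift2, opK, LinearMap.coe_mk, AddHom.coe_mk, bar_val, bar_bar, sub_sub_col]
  exact h

/-- Γ row operator. -/
noncomputable def TT (n : ℕ) (q s z : ℂ) : ℕ → Module.End ℂ (V1 n)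
  | 0 => 1
  | k + 1 => opL n q s z k * TT n q s z k

/-- Δ row operator. -/
noncomputable def MM (n : ℕ) (q s w : ℂ) : ℕ → Module.End ℂ (V1 n)
  | 0 => 1
  | k + 1 => MM n q s w k * opM n q s w k

theorem TT_comm1 (q s z w : ℂ) (k c : ℕ) (h : k ≤ c) :
    lift1 n (TT n q s z k) * lift2 n (opL n q s w c) = lift2 n (opL n q s w c) * lift1 n (TT n q s z k) := by
  induction k with
  | zero => rfl
  | succ k ih =>
    rw [TT, lift1_mul, mul_assoc, ih (by omega), ← mul_assoc, comm_loc q s z w k c (by omega), mul_assoc]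

theorem TT_comm2 (q s z w : ℂ) (k c : ℕ) (h : k ≤ c) :
    lift2 n (TT n q s w k) * lift1 n (opL n q s z c) = lift1 n (opL n q s z c) * lift2 n (TT n q s w k) := by
  have h1 := TT_comm1 (n := n) q s w z k c h
  exact congrArg (fun Y => opS n * Y * opS n) h1

theorem rtt (q s z w : ℂ) (hq : q ≠ 0) (k : ℕ) :
    opR n q z w * (lift1 n (TT n q s z k) * lift2 n (TT n q s w k))
      = (lift2 n (TT n q s w k) * lift1 n (TT n q s z k)) * opR n q z w := by
  induction k with
  | zero => rfl
  | succ k ih =>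
    rw [TT, TT, lift1_mul, lift2_mul]
    set A := lift1 n (opL n q s z k)
    set B := lift2 n (opL n q s w k)
    set T1 := lift1 n (TT n q s z k)
    set T2 := lift2 n (TT n q s w k)
    set R := opR n q z w
    have c1 : T1 * B = B * T1 := TT_comm1 q s z w k k le_rfl
    have c2 : T2 * A = A * T2 := TT_comm2 q s z w k k le_rfl
    have yb : R * (A * B) = (B * A) * R := ybe_loc q s z w hq k
    calc R * (A * T1 * (B * T2)) = R * (A * (T1 * B) * T2) := by simp only [mul_assoc]
      _ = (R * (A * B)) * (T1 * T2) := by rw [c1]; simp only [mul_assoc]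
      _ = B * A * (R * (T1 * T2)) := by rw [yb]; simp only [mul_assoc]
      _ = B * (A * T2) * T1 * R := by rw [ih]; simp only [mul_assoc]
      _ = _ := by rw [← c2]; simp only [mul_assoc]

theorem rtt' (q s z w : ℂ) (hq : q ≠ 0) (k : ℕ) :
    opR' n q z w * (lift2 n (TT n q s z k) * lift1 n (TT n q s w k))
      = (lift1 n (TT n q s w k) * lift2 n (TT n q s z k)) * opR' n q z w :=
  congrArg (fun Y => opS n * Y * opS n) (rtt q s z w hq k)

theorem TT_MM (q s z w : ℂ) (hq : q ≠ 0) (hs : s ≠ 0) (hzw : q * s^2 * z * w = 1) (k : ℕ) :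
    TT n q s z k * MM n q s w k = (((1 - z * s^2) * ((s^2)⁻¹ - w)) ^ k) • (1 : Module.End ℂ (V1 n)) := by
  induction k with
  | zero => simp [TT, MM]
  | succ k ih =>
    rw [TT, MM, mul_assoc, ← mul_assoc (TT n q s z k), ih]
    rw [smul_mul_assoc, one_mul, mul_smul_comm, inv_loc1 q s z w hq hs hzw k, smul_smul, ← pow_succ]

theorem TT_MM_comm (q s z w : ℂ) (hq : q ≠ 0) (hs : s ≠ 0) (hzw : q * s^2 * z * w = 1) (k : ℕ) :
    opL n q s z k * opM n q s w k = opM n q s w k * opL n q s z k := by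
  rw [inv_loc1 q s z w hq hs hzw k, inv_loc2 q s z w hq hs hzw k]

/-- tail version used for the second inversion -/
theorem MM_TT (q s z w : ℂ) (hq : q ≠ 0) (hs : s ≠ 0) (hzw : q * s^2 * z * w = 1) (k : ℕ) :
    MM n q s w k * TT n q s z k = (((1 - z * s^2) * ((s^2)⁻¹ - w)) ^ k) • (1 : Module.End ℂ (V1 n)) := by
  induction k with
  | zero => simp [TT, MM]
  | succ k ih =>
    rw [TT, MM, mul_assoc, ← mul_assoc (opM n q s w k), inv_loc2 q s z w hq hs hzw k]
    rw [smul_mul_assoc, one_mul, mul_smul_comm, ih, smul_smul, mul_comm, ← pow_succ]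

theorem opR'_smul (q r u v : ℂ) : opR' n q (r * u) (r * v) = r • opR' n q u v :=
  congrArg (fun Y => opS n * Y * opS n) (opR_smul (n := n) q r u v)

theorem sklyanin_abs {A : Type*} [Ring A] (R12 R21 S12 S21 T1 T2 M1 M2 K1 K2 : A)
    (h1 : R12 * (T1 * T2) = (T2 * T1) * R12) (h2 : M1 * S21 * T2 = T2 * S21 * M1)
    (h3 : T1 * S12 * M2 = M2 * S12 * T1) (h4 : R21 * (M1 * M2) = (M2 * M1) * R21)
    (k1 : K1 * T2 = T2 * K1) (k2 : M1 * K2 = K2 * M1) (k3 : T1 * K2 = K2 * T1) (k4 : K1 * M2 = M2 * K1)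
    (re : R12 * K1 * S21 * K2 = K2 * S12 * K1 * R21) :
    R12 * (T1 * K1 * M1) * S21 * (T2 * K2 * M2) = (T2 * K2 * M2) * S12 * (T1 * K1 * M1) * R21 := by
  calc R12 * (T1 * K1 * M1) * S21 * (T2 * K2 * M2)
      = R12 * T1 * K1 * (M1 * S21 * T2) * K2 * M2 := by simp only [mul_assoc]
    _ = R12 * T1 * (K1 * T2) * S21 * (M1 * K2) * M2 := by rw [h2]; simp only [mul_assoc]
    _ = (R12 * (T1 * T2)) * K1 * S21 * K2 * M1 * M2 := by rw [k1, k2]; simp only [mul_assoc]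
    _ = T2 * T1 * (R12 * K1 * S21 * K2) * M1 * M2 := by rw [h1]; simp only [mul_assoc]
    _ = T2 * T1 * K2 * S12 * K1 * (R21 * (M1 * M2)) := by rw [re]; simp only [mul_assoc]
    _ = T2 * (T1 * K2) * S12 * (K1 * M2) * M1 * R21 := by rw [h4]; simp only [mul_assoc]
    _ = T2 * K2 * (T1 * S12 * M2) * K1 * M1 * R21 := by rw [k3, k4]; simp only [mul_assoc]
    _ = _ := by rw [h3]; simp only [mul_assoc]

theorem cancel_abs {A : Type*} [Ring A] [Algebra ℂ A] (C : ℂ) (hC : C ≠ 0) (M T R X : A)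
    (hMT : M * T = C • 1) (hTM : T * M = C • 1)
    (h : R * (X * T) = (T * X) * R) : M * R * X = X * R * M := by
  have e : M * (R * (X * T)) * M = M * ((T * X) * R) * M := by rw [h]
  have e1 : M * (R * (X * T)) * M = C • (M * R * X) := by
    calc M * (R * (X * T)) * M = M * R * X * (T * M) := by simp only [mul_assoc]
      _ = _ := by rw [hTM]; simp
  have e2 : M * ((T * X) * R) * M = C • (X * R * M) := by
    calc M * ((T * X) * R) * M = (M * T) * (X * R * M) := by simp only [mul_assoc]
      _ = _ := by rw [hMT]; simp
  rw [e1, e2] at e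
  have := congrArg (fun Y => C⁻¹ • Y) e
  simpa [smul_smul, hC] using this

theorem cancel_abs2 {A : Type*} [Ring A] [Algebra ℂ A] (C D : ℂ) (hC : C ≠ 0) (hD : D ≠ 0) (M1 M2 T1 T2 R : A)
    (h1 : M1 * T1 = C • 1) (h1' : T1 * M1 = C • 1) (h2 : M2 * T2 = D • 1) (h2' : T2 * M2 = D • 1)
    (h : R * (T2 * T1) = (T1 * T2) * R) : R * (M1 * M2) = (M2 * M1) * R := by
  have e : M2 * M1 * (R * (T2 * T1)) * (M1 * M2) = M2 * M1 * ((T1 * T2) * R) * (M1 * M2) := by rw [h]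
  have e1 : M2 * M1 * (R * (T2 * T1)) * (M1 * M2) = (C * D) • (M2 * M1 * R) := by
    calc M2 * M1 * (R * (T2 * T1)) * (M1 * M2) = M2 * M1 * R * T2 * (T1 * M1) * M2 := by simp only [mul_assoc]
      _ = C • (M2 * M1 * R * (T2 * M2)) := by rw [h1']; simp [mul_assoc]
      _ = _ := by rw [h2']; simp [mul_assoc, smul_smul]
  have e2 : M2 * M1 * ((T1 * T2) * R) * (M1 * M2) = (C * D) • (R * (M1 * M2)) := by
    calc M2 * M1 * ((T1 * T2) * R) * (M1 * M2) = M2 * (M1 * T1) * T2 * R * (M1 * M2) := by simp only [mul_assoc]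
      _ = C • ((M2 * T2) * R * (M1 * M2)) := by rw [h1]; simp [mul_assoc]
      _ = _ := by rw [h2]; simp [mul_assoc, smul_smul]
  rw [e1, e2] at e
  have := congrArg (fun Y => (C * D)⁻¹ • Y) e
  simp only [smul_smul, inv_mul_cancel₀ (mul_ne_zero hC hD), one_smul] at this
  exact this.symm

/-- Double row operator. -/
noncomputable def DD (n : ℕ) (q s t p x : ℂ) (k : ℕ) : Module.End ℂ (V1 n) :=
  TT n q s (x / s) k * opK n t p * MM n q s (x / s) k

theorem smul_cancel_rel {A : Type*} [Ring A] [Algebra ℂ A] (r : ℂ) (hr : r ≠ 0) (U V R : A) 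
    (h : (r • R) * U = V * (r • R)) : R * U = V * R := by
  rw [smul_mul_assoc, mul_smul_comm] at h
  have := congrArg (fun Y => r⁻¹ • Y) h
  simpa [smul_smul, hr] using this

theorem sklyanin (q s t x y γ dx dy : ℂ) (k : ℕ) (hq : q ≠ 0) (hs : s ≠ 0) (hx : x ≠ 0) (hy : y ≠ 0)
    (hsx : 1 - s * x ≠ 0) (hsy : 1 - s * y ≠ 0) (hqx : q * x - s ≠ 0) (hqy : q * y - s ≠ 0)
    (hdx : dx = q * x^2 + γ * x - t) (hdy : dy = q * y^2 + γ * y - t)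
    (hdx0 : dx ≠ 0) (hdy0 : dy ≠ 0) :
    opR n q x y * lift1 n (DD n q s t ((q*x^2-1)/dx) x k) * opR' n q (q*x*y) 1
        * lift2 n (DD n q s t ((q*y^2-1)/dy) y k)
     = lift2 n (DD n q s t ((q*y^2-1)/dy) y k) * opR n q (q*x*y) 1
        * lift1 n (DD n q s t ((q*x^2-1)/dx) x k) * opR' n q x y := by
  unfold DD
  simp only [lift1_mul, lift2_mul]
  have inv : ∀ z : ℂ, z ≠ 0 → 1 - s * z ≠ 0 → q * z - s ≠ 0 →
      ∃ C : ℂ, C ≠ 0 ∧ TT n q s (1 / (q * s * z)) k * MM n q s (z / s) k = C • 1 ∧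
        MM n q s (z / s) k * TT n q s (1 / (q * s * z)) k = C • 1 := by
    intro z hz h1 h2
    have hzw : q * s^2 * (1 / (q * s * z)) * (z / s) = 1 := by field_simp
    refine ⟨_, ?_, TT_MM q s _ _ hq hs hzw k, MM_TT q s _ _ hq hs hzw k⟩
    apply pow_ne_zero
    have e : (1 - 1 / (q * s * z) * s ^ 2) * ((s ^ 2)⁻¹ - z / s)
        = (q * z - s) * (1 - s * z) / (q * z * s^2) := by field_simp
    rw [e]
    exact div_ne_zero (mul_ne_zero h2 h1) (by positivity)
  obtain ⟨Cx, hCx, ix1, ix2⟩ := inv x hx hsx hqx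
  obtain ⟨Cy, hCy, iy1, iy2⟩ := inv y hy hsy hqy
  set T1 := lift1 n (TT n q s (x/s) k)
  set T2 := lift2 n (TT n q s (y/s) k)
  set M1 := lift1 n (MM n q s (x/s) k)
  set M2 := lift2 n (MM n q s (y/s) k)
  have jx1 : lift1 n (TT n q s (1/(q*s*x)) k) * M1 = Cx • 1 := by
    rw [← lift1_mul, ix1]; rfl
  have jx2 : M1 * lift1 n (TT n q s (1/(q*s*x)) k) = Cx • 1 := by
    rw [← lift1_mul, ix2]; rfl
  have jy1 : lift2 n (TT n q s (1/(q*s*y)) k) * M2 = Cy • 1 := by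
    rw [← lift2_mul, iy1]; rfl
  have jy2 : M2 * lift2 n (TT n q s (1/(q*s*y)) k) = Cy • 1 := by
    rw [← lift2_mul, iy2]; rfl
  apply sklyanin_abs
  · have h := rtt (n := n) q s (x/s) (y/s) hq k
    rw [show x / s = s⁻¹ * x by ring, show y / s = s⁻¹ * y by ring, opR_smul] at h
    rw [show s⁻¹ * x = x / s by ring, show s⁻¹ * y = y / s by ring] at h
    exact smul_cancel_rel _ (inv_ne_zero hs) _ _ _ h
  · have h := rtt' (n := n) q s (y/s) (1/(q*s*x)) hq k
    have hr : opR' n q (y/s) (1/(q*s*x)) = (1/(q*s*x)) • opR' n q (q*x*y) 1 := by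
      rw [← opR'_smul]; congr 1 <;> field_simp
    rw [hr] at h
    exact cancel_abs Cx hCx _ _ _ _ jx2 jx1 (smul_cancel_rel _ (one_div_ne_zero (by simp [hq, hs, hx, hy])) _ _ _ h)
  · have h := rtt (n := n) q s (x/s) (1/(q*s*y)) hq k
    have hr : opR n q (x/s) (1/(q*s*y)) = (1/(q*s*y)) • opR n q (q*x*y) 1 := by
      rw [← opR_smul]; congr 1 <;> field_simp
    rw [hr] at h
    exact (cancel_abs Cy hCy _ _ _ _ jy2 jy1 (smul_cancel_rel _ (one_div_ne_zero (by simp [hq, hs, hx, hy])) _ _ _ h)).symm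
  · have h := rtt' (n := n) q s (1/(q*s*y)) (1/(q*s*x)) hq k
    have hr : opR' n q (1/(q*s*y)) (1/(q*s*x)) = (1/(q*s*x*y)) • opR' n q x y := by
      rw [← opR'_smul]; congr 1 <;> field_simp
    rw [hr] at h
    have h := (smul_cancel_rel _ (one_div_ne_zero (by simp [hq, hs, hx, hy])) _ _ _ h)
    exact cancel_abs2 Cx Cy hCx hCy _ _ _ _ _ jx2 jx1 jy2 jy1 h
  · exact lift_comm_K1 _ _ _
  · exact (lift_comm_K2 _ _ _).symm
  · exact (lift_comm_K2 _ _ _).symm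
  · exact lift_comm_K1 _ _ _
  · exact refl_op q t x y γ dx dy hdx hdy hdx0 hdy0

end mono


section exch
variable {n : ℕ}

/-- Functions of the vertical configuration. -/
abbrev V0 (n : ℕ) := Idx n → ℂ

/-- Embedding with outgoing color `0`. -/
def incl (n : ℕ) : V0 n →ₗ[ℂ] V1 n where
  toFun ψ := fun c I => if c = mid n then ψ I else 0
  map_add' φ ψ := by
    funext c I
    by_cases h : c = mid n <;> simp [h]
  map_smul' r φ := by
    funext c I
    by_cases h : c = mid n <;> simp [h]

/-- Operator of a double row with incoming color `a`. -/
noncomputable def Dop (n : ℕ) (q s t p x : ℂ) (k : ℕ) (a : Col n) : Module.End ℂ (V0 n) where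
  toFun ψ := fun I => DD n q s t p x k (incl n ψ) a I
  map_add' φ ψ := by
    funext I
    simp only [map_add]; rfl
  map_smul' r φ := by
    funext I
    simp only [map_smul]; rfl

theorem exchange (q s t x y γ dx dy : ℂ) (k : ℕ) (hq : q ≠ 0) (hs : s ≠ 0) (hx : x ≠ 0) (hy : y ≠ 0)
    (hsx : 1 - s * x ≠ 0) (hsy : 1 - s * y ≠ 0) (hqx : q * x - s ≠ 0) (hqy : q * y - s ≠ 0)
    (hdx : dx = q * x^2 + γ * x - t) (hdy : dy = q * y^2 + γ * y - t)
    (hdx0 : dx ≠ 0) (hdy0 : dy ≠ 0) (a b : Col n) (ha : a ≠ mid n) (hb : b ≠ mid n) (hab : a < b) :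
    (q * (x - y) * rF q (q*x*y) 1 b (mid n)) •
        (Dop n q s t ((q*x^2-1)/dx) x k a * Dop n q s t ((q*y^2-1)/dy) y k b)
      + ((1 - q) * x * rF q (q*x*y) 1 a (mid n)) •
        (Dop n q s t ((q*x^2-1)/dx) x k b * Dop n q s t ((q*y^2-1)/dy) y k a)
    = ((x - q * y) * rF q (q*x*y) 1 a (mid n)) •
        (Dop n q s t ((q*y^2-1)/dy) y k b * Dop n q s t ((q*x^2-1)/dx) x k a) := by
  refine LinearMap.ext fun ψ => ?_
  funext I
  have h := sklyanin (n := n) q s t x y γ dx dy k hq hs hx hy hsx hsy hqx hqy hdx hdy hdx0 hdy0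
  set Ax := DD n q s t ((q*x^2-1)/dx) x k with hAx
  set Ay := DD n q s t ((q*y^2-1)/dy) y k with hAy
  set X := fun c => Dop n q s t ((q*x^2-1)/dx) x k c with hX
  set Y := fun c => Dop n q s t ((q*y^2-1)/dy) y k c with hY
  set Φ : V2 n := fun c d J => if c = mid n ∧ d = mid n then ψ J else 0 with hΦ
  have h' := congrFun (congrFun (congrFun (LinearMap.congr_fun h Φ) a) b) I
  simp only [Module.End.mul_apply] at h'
  have e1 : lift2 n Ay Φ = fun c d J => if c = mid n then Y d ψ J else 0 := by
    funext c d J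
    change Ay (fun c' J' => Φ c c' J') d J = _
    by_cases hc : c = mid n
    · simp only [hΦ, hc, true_and, if_true]; rfl
    · have : (fun c' J' => Φ c c' J') = 0 := by funext c' J'; simp [hΦ, hc]
      rw [this, map_zero, if_neg hc]; rfl
  have e1' : lift1 n Ax Φ = fun c d J => if d = mid n then X c ψ J else 0 := by
    funext c d J
    change Ax (fun c' J' => Φ c' d J') c J = _
    by_cases hc : d = mid n
    · simp only [hΦ, hc, and_true, if_true]; rfl
    · have : (fun c' J' => Φ c' d J') = 0 := by funext c' J'; simp [hΦ, hc]
      rw [this, map_zero, if_neg hc]; rfl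
  have e2 : opR' n q x y Φ = (x - q * y) • Φ := by
    funext c d J
    change rF q x y d c * Φ c d J + rG q x y d c * Φ d c J = (x - q * y) * Φ c d J
    by_cases hc : c = mid n ∧ d = mid n
    · simp [hΦ, hc.1, hc.2, rF, rG]
    · have hc' : ¬ (d = mid n ∧ c = mid n) := fun h => hc ⟨h.2, h.1⟩
      simp [hΦ, hc, hc']
  have e3 : ∀ c d : Col n, d ≠ mid n → ∀ J, lift1 n Ax (opR' n q (q*x*y) 1 (lift2 n Ay Φ)) c d J
      = rF q (q*x*y) 1 d (mid n) * X c (Y d ψ) J := by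
    intro c d hd J
    rw [e1]
    change Ax (fun c' J' => rF q (q*x*y) 1 d c' * (if c' = mid n then Y d ψ J' else 0)
      + rG q (q*x*y) 1 d c' * (if d = mid n then Y c' ψ J' else 0)) c J = _
    have : (fun (c' : Col n) (J' : Idx n) => rF q (q*x*y) 1 d c' * (if c' = mid n then Y d ψ J' else 0)
      + rG q (q*x*y) 1 d c' * (if d = mid n then Y c' ψ J' else 0))
      = rF q (q*x*y) 1 d (mid n) • incl n (Y d ψ) := by
      funext c' J'
      change _ = rF q (q*x*y) 1 d (mid n) * (if c' = mid n then Y d ψ J' else 0)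
      by_cases hc : c' = mid n <;> simp [hd, hc]
    rw [this, map_smul]; rfl
  have e4 : lift2 n Ay (opR n q (q*x*y) 1 (lift1 n Ax (opR' n q x y Φ))) a b I
      = (x - q * y) * (rF q (q*x*y) 1 a (mid n) * Y b (X a ψ) I) := by
    rw [e2, map_smul, map_smul, map_smul, e1']
    change (x - q * y) * Ay (fun c' J' => rF q (q*x*y) 1 a c' * (if c' = mid n then X a ψ J' else 0)
      + rG q (q*x*y) 1 a c' * (if a = mid n then X c' ψ J' else 0)) b I = _
    have : (fun (c' : Col n) (J' : Idx n) => rF q (q*x*y) 1 a c' * (if c' = mid n then X a ψ J' else 0)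
      + rG q (q*x*y) 1 a c' * (if a = mid n then X c' ψ J' else 0))
      = rF q (q*x*y) 1 a (mid n) • incl n (X a ψ) := by
      funext c' J'
      change _ = rF q (q*x*y) 1 a (mid n) * (if c' = mid n then X a ψ J' else 0)
      by_cases hc : c' = mid n <;> simp [ha, hc]
    rw [this, map_smul]; rfl
  rw [e4] at h'
  have e5 : ∀ G : V2 n, opR n q x y G a b I = q * (x - y) * G a b I + (1 - q) * x * G b a I := by
    intro G
    have hab' : a.val < b.val := hab
    change rF q x y a b * G a b I + rG q x y a b * G b a I = _
    simp [rF, rG, hab', hab'.ne]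
  rw [e5, e3 a b hb, e3 b a ha] at h'
  change (q * (x - y) * rF q (q*x*y) 1 b (mid n)) * (X a (Y b ψ) I)
      + ((1 - q) * x * rF q (q*x*y) 1 a (mid n)) * (X b (Y a ψ) I)
      = ((x - q * y) * rF q (q*x*y) 1 a (mid n)) * (Y b (X a ψ) I)
  linear_combination h'

/-- Ordered product of operators, the last one acting outermost. -/
def Zrec {A : Type*} [Monoid A] (D : ℕ → A) : ℕ → A
  | 0 => 1
  | k + 1 => D k * Zrec D k

theorem Zrec_exch {A : Type*} [Ring A] [Algebra ℂ A] (D D' D'' : ℕ → A) (α β δ : ℂ) (i : ℕ)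
    (h : α • (D' (i+1) * D' i) = β • (D (i+1) * D i) + δ • (D'' (i+1) * D'' i))
    (h1 : ∀ j, j ≠ i → j ≠ i + 1 → D' j = D j) (h2 : ∀ j, j ≠ i → j ≠ i + 1 → D'' j = D j)
    (m : ℕ) (hm : i + 2 ≤ m) :
    α • Zrec D' m = β • Zrec D m + δ • Zrec D'' m := by
  have low : ∀ (E E' : ℕ → A), (∀ j, j ≠ i → j ≠ i + 1 → E j = E' j) → ∀ k ≤ i, Zrec E k = Zrec E' k := by
    intro E E' hE k hk
    induction k with
    | zero => rfl
    | succ k ih => rw [Zrec, Zrec, ih (by omega), hE k (by omega) (by omega)]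
  induction m, hm using Nat.le_induction with
  | base =>
    have e : ∀ E : ℕ → A, Zrec E (i+2) = E (i+1) * E i * Zrec E i := fun E => by
      rw [Zrec, Zrec, mul_assoc]
    rw [e, e, e, low D' D h1 i le_rfl, low D'' D h2 i le_rfl, ← smul_mul_assoc, h, add_mul,
      smul_mul_assoc, smul_mul_assoc]
  | succ m hm ih =>
    rw [Zrec, Zrec, Zrec, h1 m (by omega) (by omega), h2 m (by omega) (by omega), ← mul_smul_comm, ih,
      mul_add, mul_smul_comm, mul_smul_comm]

end exch


section rows
variable {n : ℕ}

/-- Change of the vertical configuration along a row of Γ vertices. -/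
def incG (n k : ℕ) (f : Fin (k+1) → Col n) : Idx n := fun c =>
  if h : c < k then eZ n (f ⟨c+1, by omega⟩) - eZ n (f ⟨c, by omega⟩) else 0

theorem snoc_zero' (k : ℕ) (g : Fin (k+1) → Col n) (a : Col n) :
    (Fin.snoc g a : Fin (k+2) → Col n) 0 = g 0 := by
  have : (0 : Fin (k+2)) = Fin.castSucc (0 : Fin (k+1)) := rfl
  rw [this, Fin.snoc_castSucc (α := fun _ => Col n)]

theorem incG_snoc (k : ℕ) (g : Fin (k+1) → Col n) (a : Col n) :
    incG n (k+1) (Fin.snoc g a : Fin (k+2) → Col n) = incG n k g + incr n k a (g (Fin.last k)) := by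
  funext c
  simp only [incG, incr, Pi.add_apply]
  rcases lt_trichotomy c k with h | h | h
  · rw [dif_pos (by omega), dif_pos h, if_neg (by omega), add_zero]
    have e1 : (⟨c+1, by omega⟩ : Fin (k+1+1)) = Fin.castSucc ⟨c+1, by omega⟩ := rfl
    have e2 : (⟨c, by omega⟩ : Fin (k+1+1)) = Fin.castSucc ⟨c, by omega⟩ := rfl
    rw [e1, e2, Fin.snoc_castSucc (α := fun _ => Col n), Fin.snoc_castSucc (α := fun _ => Col n)]
  · subst h
    rw [dif_pos (by omega), dif_neg (by omega), if_pos rfl, zero_add]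
    have e1 : (⟨c+1, by omega⟩ : Fin (c+1+1)) = Fin.last (c+1) := rfl
    have e2 : (⟨c, by omega⟩ : Fin (c+1+1)) = Fin.castSucc (Fin.last c) := rfl
    rw [e1, e2, Fin.snoc_castSucc (α := fun _ => Col n), Fin.snoc_last (α := fun _ => Col n)]
  · rw [dif_neg (by omega), dif_neg (by omega), if_neg (by omega), add_zero]

theorem sum_snoc (k : ℕ) (F : (Fin (k+2) → Col n) → ℂ) :
    ∑ f : Fin (k+2) → Col n, F f = ∑ a : Col n, ∑ g : Fin (k+1) → Col n, F (Fin.snoc g a) := by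
  rw [← Equiv.sum_comp (Fin.snocEquiv (fun _ : Fin (k+2) => Col n)), Fintype.sum_prod_type]
  rfl

theorem TT_exp (q s z : ℂ) (k : ℕ) (φ : V1 n) (a : Col n) (I : Idx n) :
    TT n q s z k φ a I = ∑ f : Fin (k+1) → Col n, if f (Fin.last k) = a then
      (∏ c : Fin k, ellN z (Pk n q s (I c)) (f c.succ) (f c.castSucc)) * φ (f 0) (I + incG n k f) else 0 := by
  induction k generalizing a I with
  | zero =>
    have h0 : ∀ f : Fin 1 → Col n, I + incG n 0 f = I := by
      intro f; funext c; simp [incG]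
    simp only [h0]
    rw [← Equiv.sum_comp (Equiv.funUnique (Fin 1) (Col n)).symm]
    simp [TT]
  | succ k ih =>
    rw [sum_snoc, Finset.sum_eq_single a]
    · change ∑ l : Col n, ellN z (Pk n q s (I k)) a l * TT n q s z k φ l (I + incr n k a l) = _
      simp only [ih, Finset.mul_sum]
      rw [Finset.sum_comm]
      refine Finset.sum_congr rfl fun g _ => ?_
      rw [Finset.sum_eq_single (g (Fin.last k))]
      · rw [if_pos rfl, if_pos (Fin.snoc_last (α := fun _ => Col n) _ _), Fin.prod_univ_castSucc, incG_snoc, snoc_zero']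
        have e1 : ∀ c : Fin k, (I + incr n k a (g (Fin.last k))) c = I c := fun c =>
          incr_other k c (by have := c.isLt; omega) _ _ _
        have e2 : ∀ c : Fin k, (Fin.snoc g a : Fin (k+2) → Col n) (Fin.succ (Fin.castSucc c)) = g c.succ := by
          intro c
          rw [Fin.succ_castSucc, Fin.snoc_castSucc (α := fun _ => Col n)]
        simp only [e1, e2, Fin.snoc_castSucc (α := fun _ => Col n), Fin.succ_last,
          Fin.snoc_last (α := fun _ => Col n), Fin.val_last, Fin.val_castSucc]
        rw [add_right_comm, add_assoc I]
        ring
      · intro l _ hl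
        rw [if_neg (fun h => hl h.symm), mul_zero]
      · simp
    · intro b _ hb
      refine Finset.sum_eq_zero fun g _ => ?_
      rw [if_neg]
      rw [Fin.snoc_last (α := fun _ => Col n)]
      exact hb
    · simp

theorem MM_exp (q s w : ℂ) (k : ℕ) (φ : V1 n) (a : Col n) (I : Idx n) :
    MM n q s w k φ a I = ∑ f : Fin (k+1) → Col n, if f 0 = a then
      (∏ c : Fin k, emN w (Pk n q s (I c)) (f c.castSucc) (f c.succ)) * φ (f (Fin.last k)) (I - incG n k f)
      else 0 := by
  induction k generalizing φ with
  | zero =>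
    have h0 : ∀ f : Fin 1 → Col n, I - incG n 0 f = I := by
      intro f; funext c; simp [incG]
    simp only [h0]
    rw [← Equiv.sum_comp (Equiv.funUnique (Fin 1) (Col n)).symm]
    simp [MM]
  | succ k ih =>
    rw [sum_snoc, Finset.sum_comm, MM, Module.End.mul_apply, ih]
    refine Finset.sum_congr rfl fun g _ => ?_
    simp only [snoc_zero']
    by_cases hg : g 0 = a
    · simp only [if_pos hg]
      change _ * (∑ l : Col n, emN w (Pk n q s ((I - incG n k g) k)) (g (Fin.last k)) l *
        φ l (I - incG n k g + incr n k (g (Fin.last k)) l)) = _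
      rw [Finset.mul_sum]
      refine Finset.sum_congr rfl fun l _ => ?_
      rw [Fin.prod_univ_castSucc, incG_snoc]
      have e1 : (I - incG n k g) k = I k := by simp [incG]
      have e2 : ∀ c : Fin k, (Fin.snoc g l : Fin (k+2) → Col n) (Fin.succ (Fin.castSucc c)) = g c.succ := by
        intro c
        rw [Fin.succ_castSucc, Fin.snoc_castSucc (α := fun _ => Col n)]
      have e3 : I - incG n k g + incr n k (g (Fin.last k)) l
          = I - (incG n k g + incr n k l (g (Fin.last k))) := by
        have : incr n k (g (Fin.last k)) l = - incr n k l (g (Fin.last k)) := by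
          funext c
          by_cases h : c = k <;> simp [incr, h]
        rw [this]; abel
      simp only [e1, e2, e3, Fin.snoc_castSucc (α := fun _ => Col n), Fin.succ_last,
          Fin.snoc_last (α := fun _ => Col n), Fin.val_last, Fin.val_castSucc]
      ring
    · simp [if_neg hg]

/-- Weight of a double row. -/
noncomputable def wD (n : ℕ) (q s t p x : ℂ) (L : ℕ) (a : Col n) (I : Idx n)
    (f g : Fin (L+1) → Col n) : ℂ :=
  if f (Fin.last L) = a ∧ g (Fin.last L) = mid n then
    (∏ c : Fin L, ellN (x/s) (Pk n q s (I c)) (f c.succ) (f c.castSucc)) *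
    ((if g 0 = barC n (f 0) then kap n t p (f 0) else 0) + (if g 0 = f 0 then 1 - kap n t p (f 0) else 0)) *
    (∏ c : Fin L, emN (x/s) (Pk n q s ((I + incG n L f) c)) (g c.castSucc) (g c.succ))
  else 0

theorem Dop_exp (q s t p x : ℂ) (L : ℕ) (a : Col n) (ψ : V0 n) (I : Idx n) :
    Dop n q s t p x L a ψ I = ∑ fg : (Fin (L+1) → Col n) × (Fin (L+1) → Col n),
      wD n q s t p x L a I fg.1 fg.2 * ψ (I + (incG n L fg.1 - incG n L fg.2)) := by
  rw [Fintype.sum_prod_type]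
  change TT n q s (x/s) L (opK n t p (MM n q s (x/s) L (incl n ψ))) a I = _
  rw [TT_exp]
  refine Finset.sum_congr rfl fun f _ => ?_
  by_cases hf : f (Fin.last L) = a
  · rw [if_pos hf]
    change _ * (kap n t p (f 0) * MM n q s (x/s) L (incl n ψ) (barC n (f 0)) (I + incG n L f)
      + (1 - kap n t p (f 0)) * MM n q s (x/s) L (incl n ψ) (f 0) (I + incG n L f)) = _
    rw [MM_exp, MM_exp, Finset.mul_sum, Finset.mul_sum, ← Finset.sum_add_distrib, Finset.mul_sum]
    refine Finset.sum_congr rfl fun g _ => ?_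
    have e : incl n ψ (g (Fin.last L)) (I + incG n L f - incG n L g)
        = if g (Fin.last L) = mid n then ψ (I + (incG n L f - incG n L g)) else 0 := by
      rw [add_sub_assoc]; rfl
    rw [e]
    unfold wD
    by_cases hg : g (Fin.last L) = mid n
    · simp only [hf, hg, true_and, if_true]
      split_ifs <;> ring
    · simp [hg]
  · rw [if_neg hf]
    symm
    refine Finset.sum_eq_zero fun g _ => ?_
    simp [wD, hf]

end rows


section wts
variable {n : ℕ}

/-- Cast of a natural vector. -/
def ivec (n : ℕ) (I : Vec n) : Col n → ℤ := fun k => (I k : ℤ)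

theorem sLe_eq (I : Vec n) (l : Col n) : sLe n I l = sLt n I l + I l := by
  unfold sLe sLt
  have : Finset.univ.filter (fun k : Col n => k ≤ l)
      = insert l (Finset.univ.filter (fun k : Col n => k < l)) := by
    ext k; simp [le_iff_lt_or_eq, or_comm]
  rw [this, Finset.sum_insert (by simp), add_comm]

theorem sGe_eq (I : Vec n) (l : Col n) : sGe n I l = sGt n I l + I l := by
  unfold sGe sGt
  have : Finset.univ.filter (fun k : Col n => l ≤ k)
      = insert l (Finset.univ.filter (fun k : Col n => l < k)) := by
    ext k; simp [le_iff_lt_or_eq, or_comm, eq_comm]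
  rw [this, Finset.sum_insert (by simp), add_comm]

theorem Pk_lo (q s : ℂ) (I : Vec n) (l : Col n) (h : l.val ≤ n) :
    Pk n q s (ivec n I) l.val = q ^ (-(sLt n I l : ℤ)) := by
  simp only [Pk, if_pos h, sLt, ivec, Nat.cast_sum]
  rfl

theorem Pk_lo1 (q s : ℂ) (I : Vec n) (l : Col n) (h : l.val < n) :
    Pk n q s (ivec n I) (l.val+1) = q ^ (-(sLe n I l : ℤ)) := by
  have h' : l.val + 1 ≤ n := h
  simp only [Pk, if_pos h', sLe, ivec, Nat.cast_sum, Nat.lt_succ_iff]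
  rfl

theorem Pk_hi (q s : ℂ) (I : Vec n) (l : Col n) (h : n < l.val) :
    Pk n q s (ivec n I) l.val = s^2 * q ^ (sGe n I l : ℤ) := by
  simp only [Pk, if_neg (not_le.2 h), sGe, ivec, Nat.cast_sum]
  rfl

theorem Pk_hi1 (q s : ℂ) (I : Vec n) (l : Col n) (h : n ≤ l.val) :
    Pk n q s (ivec n I) (l.val+1) = s^2 * q ^ (sGt n I l : ℤ) := by
  have h' : ¬ (l.val + 1 ≤ n) := by omega
  rw [Pk, if_neg h']
  simp only [sGt, ivec, Nat.cast_sum, Nat.succ_le_iff]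
  rfl

theorem ellN_lt (z : ℂ) (P : ℕ → ℂ) (j l : ℕ) (h : j < l) : ellN z P j l = z * (P l - P (l+1)) := by
  simp only [ellN, gG]; rw [if_neg (by omega), if_neg (by omega)]; ring
theorem ellN_gt (z : ℂ) (P : ℕ → ℂ) (j l : ℕ) (h : l < j) : ellN z P j l = (P l - P (l+1)) := by
  simp only [ellN, gG]; rw [if_pos (by omega), if_pos (by omega)]
theorem ellN_eq (z : ℂ) (P : ℕ → ℂ) (l : ℕ) : ellN z P l l = P l - z * P (l+1) := by
  simp only [ellN, gG]; rw [if_pos (by omega), if_neg (by omega)]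
theorem emN_lt (z : ℂ) (P : ℕ → ℂ) (j l : ℕ) (h : j < l) : emN z P j l = (P (l+1))⁻¹ - (P l)⁻¹ := by
  simp only [emN, hH]; rw [if_neg (by omega), if_neg (by omega)]
theorem emN_gt (z : ℂ) (P : ℕ → ℂ) (j l : ℕ) (h : l < j) : emN z P j l = z * ((P (l+1))⁻¹ - (P l)⁻¹) := by
  simp only [emN, hH]; rw [if_pos (by omega), if_pos (by omega)]; ring
theorem emN_eq (z : ℂ) (P : ℕ → ℂ) (l : ℕ) : emN z P l l = (P (l+1))⁻¹ - z * (P l)⁻¹ := by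
  simp only [emN, hH]; rw [if_neg (by omega), if_pos (by omega)]

theorem LW_eq (q s x : ℂ) (hq : q ≠ 0) (hs : s ≠ 0) (hsx : 1 - s * x ≠ 0) (I K : Vec n) (j l : Col n)
    (h : ∀ k, I k + eV n j k = K k + eV n l k) :
    LW n q s x I j K l = ellN (x/s) (Pk n q s (ivec n I)) j l / (1 - s * x) := by
  unfold LW
  rw [if_pos h]
  have hm : (mid n).val = n := rfl
  have hlo : sLo n I = sLt n I (mid n) := rfl
  have hhi : sHi n I = sGt n I (mid n) := rfl
  rcases lt_trichotomy l (mid n) with hl | hl | hl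
  · have hl' : l.val < n := hl
    have e1 := Pk_lo q s I l hl'.le
    have e2 := Pk_lo1 q s I l hl'
    rw [sLe_eq] at e2
    simp only [if_neg hl.ne, if_pos hl, sLe_eq]
    rcases lt_trichotomy j l with hj | hj | hj
    · rw [if_neg hj.ne, if_pos hj, ellN_lt _ _ _ _ hj, e1, e2]
      push_cast
      simp only [neg_add, zpow_add₀ hq, zpow_neg]
      field_simp
      ring
    · rw [if_pos hj, hj, ellN_eq, e1, e2]
      push_cast
      simp only [neg_add, zpow_add₀ hq, zpow_neg]
      field_simp
    · rw [if_neg hj.ne', if_neg (not_lt.2 hj.le), ellN_gt _ _ _ _ hj, e1, e2]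
      push_cast
      simp only [neg_add, zpow_add₀ hq, zpow_neg]
      field_simp
      ring
  · have hl' : l.val = n := by rw [hl]; rfl
    have e1 := Pk_lo q s I l hl'.le
    have e2 := Pk_hi1 q s I l hl'.ge
    simp only [hlo, hhi, ← hl, if_true]
    rcases lt_trichotomy j l with hj | hj | hj
    · rw [if_neg hj.ne, if_pos hj, ellN_lt _ _ _ _ hj, e1, e2]
      field_simp
    · rw [if_pos hj, hj, ellN_eq, e1, e2]
      field_simp
    · rw [if_neg hj.ne', if_neg (not_lt.2 hj.le), ellN_gt _ _ _ _ hj, e1, e2]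
  · have hl' : n < l.val := hl
    have e1 := Pk_hi q s I l hl'
    have e2 := Pk_hi1 q s I l hl'.le
    rw [sGe_eq] at e1
    simp only [if_neg hl.ne', if_neg (not_lt.2 hl.le)]
    rcases lt_trichotomy j l with hj | hj | hj
    · rw [if_neg hj.ne, if_pos hj, ellN_lt _ _ _ _ hj, e1, e2]
      push_cast
      simp only [zpow_add₀ hq]
      field_simp
      ring
    · rw [if_pos hj, hj, ellN_eq, e1, e2]
      push_cast
      simp only [zpow_add₀ hq]
      field_simp
    · rw [if_neg hj.ne', if_neg (not_lt.2 hj.le), ellN_gt _ _ _ _ hj, e1, e2]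
      push_cast
      simp only [zpow_add₀ hq]
      field_simp
      ring

theorem MW_eq (q s x : ℂ) (hq : q ≠ 0) (hs : s ≠ 0) (hsx : 1 - s * x ≠ 0) (I K : Vec n) (j l : Col n)
    (h : ∀ k, I k + eV n j k = K k + eV n l k) :
    MW n q s x I j K l = s^2 * emN (x/s) (Pk n q s (ivec n I)) j l / (1 - s * x) := by
  unfold MW
  rw [if_pos h]
  have hm : (mid n).val = n := rfl
  have hlo : sLo n I = sLt n I (mid n) := rfl
  have hhi : sHi n I = sGt n I (mid n) := rfl
  rcases lt_trichotomy l (mid n) with hl | hl | hl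
  · have hl' : l.val < n := hl
    have e1 := Pk_lo q s I l hl'.le
    have e2 := Pk_lo1 q s I l hl'
    rw [sLe_eq] at e2
    simp only [if_neg hl.ne, if_pos hl]
    rcases lt_trichotomy j l with hj | hj | hj
    · rw [if_neg hj.ne, if_pos hj, emN_lt _ _ _ _ hj, e1, e2]
      push_cast
      simp only [neg_add, zpow_add₀ hq, zpow_neg]
      field_simp
      ring
    · rw [if_pos hj, hj, emN_eq, e1, e2]
      push_cast
      simp only [neg_add, zpow_add₀ hq, zpow_neg]
      field_simp
    · rw [if_neg hj.ne', if_neg (not_lt.2 hj.le), emN_gt _ _ _ _ hj, e1, e2]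
      push_cast
      simp only [neg_add, zpow_add₀ hq, zpow_neg]
      field_simp
      ring
  · have hl' : l.val = n := by rw [hl]; rfl
    have e1 := Pk_lo q s I l hl'.le
    have e2 := Pk_hi1 q s I l hl'.ge
    simp only [hlo, hhi, ← hl, if_true]
    rcases lt_trichotomy j l with hj | hj | hj
    · rw [if_neg hj.ne, if_pos hj, emN_lt _ _ _ _ hj, e1, e2]
      simp only [zpow_neg]
      field_simp
    · rw [if_pos hj, hj, emN_eq, e1, e2]
      simp only [zpow_neg]
      field_simp
    · rw [if_neg hj.ne', if_neg (not_lt.2 hj.le), emN_gt _ _ _ _ hj, e1, e2]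
      simp only [zpow_neg]
      field_simp
  · have hl' : n < l.val := hl
    have e1 := Pk_hi q s I l hl'
    have e2 := Pk_hi1 q s I l hl'.le
    rw [sGe_eq] at e1
    simp only [if_neg hl.ne', if_neg (not_lt.2 hl.le), sGe_eq]
    rcases lt_trichotomy j l with hj | hj | hj
    · rw [if_neg hj.ne, if_pos hj, emN_lt _ _ _ _ hj, e1, e2]
      push_cast
      simp only [neg_add, zpow_add₀ hq, zpow_neg]
      field_simp
      ring
    · rw [if_pos hj, hj, emN_eq, e1, e2]
      push_cast
      simp only [neg_add, zpow_add₀ hq, zpow_neg]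
      field_simp
    · rw [if_neg hj.ne', if_neg (not_lt.2 hj.le), emN_gt _ _ _ _ hj, e1, e2]
      push_cast
      simp only [neg_add, zpow_add₀ hq, zpow_neg]
      field_simp
      ring

theorem Pk_flat (q s : ℂ) (I : Col n → ℤ) (l : Col n) (hl : l ≠ mid n) (h0 : I l = 0) :
    Pk n q s I (l.val + 1) = Pk n q s I l.val := by
  have hne : l.val ≠ n := fun h => hl (Fin.ext h)
  unfold Pk
  rcases lt_or_gt_of_ne hne with h | h
  · rw [if_pos (by omega), if_pos (by omega)]
    have : Finset.univ.filter (fun c : Col n => c.val < l.val + 1)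
        = insert l (Finset.univ.filter (fun c : Col n => c.val < l.val)) := by
      ext c
      simp only [Finset.mem_filter, Finset.mem_univ, true_and, Finset.mem_insert, Fin.ext_iff]
      omega
    rw [this, Finset.sum_insert (by simp), h0, zero_add]
  · rw [if_neg (by omega), if_neg (by omega)]
    have : Finset.univ.filter (fun c : Col n => l.val ≤ c.val)
        = insert l (Finset.univ.filter (fun c : Col n => l.val + 1 ≤ c.val)) := by
      ext c
      simp only [Finset.mem_filter, Finset.mem_univ, true_and, Finset.mem_insert, Fin.ext_iff]
      omega
    rw [this, Finset.sum_insert (by simp), h0, zero_add]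

theorem ellN_zero (q s z : ℂ) (I : Col n → ℤ) (j l : Col n) (hl : l ≠ mid n) (h0 : I l = 0) (hj : j ≠ l) :
    ellN z (Pk n q s I) j l = 0 := by
  rcases lt_or_gt_of_ne hj with h | h
  · rw [ellN_lt _ _ _ _ h, Pk_flat q s I l hl h0]; ring
  · rw [ellN_gt _ _ _ _ h, Pk_flat q s I l hl h0]; ring

theorem emN_zero (q s z : ℂ) (I : Col n → ℤ) (j l : Col n) (hl : l ≠ mid n) (h0 : I l = 0) (hj : j ≠ l) :
    emN z (Pk n q s I) j l = 0 := by
  rcases lt_or_gt_of_ne hj with h | h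
  · rw [emN_lt _ _ _ _ h, Pk_flat q s I l hl h0]; ring
  · rw [emN_gt _ _ _ _ h, Pk_flat q s I l hl h0]; ring

theorem bar_ne (a : Col n) (h : a ≠ mid n) : barC n a ≠ a := by
  intro h'
  apply h
  apply Fin.ext
  have h2 : 2 * n - a.val = a.val := congrArg Fin.val h'
  have := a.isLt
  change a.val = n
  omega

theorem bar_mid : barC n (mid n) = mid n := by
  apply Fin.ext
  change 2 * n - n = n
  omega

theorem capW_eq (ν t qh x : ℂ) (ε ε' : Col n) : capW n ν t qh x ε ε' =
    (if ε' = barC n ε then kap n t (phiF ν t (qh * x⁻¹)) ε else 0)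
      + (if ε' = ε then 1 - kap n t (phiF ν t (qh * x⁻¹)) ε else 0) := by
  unfold capW kap
  rcases lt_trichotomy ε (mid n) with h | h | h
  · have h1 : ε.val < n := h
    have hb := bar_ne ε h.ne
    by_cases e1 : ε' = barC n ε
    · subst e1
      simp [h, h1, h.ne, hb]
    · by_cases e2 : ε' = ε
      · subst e2; simp [h, h1, h.ne, hb.symm]
      · simp [h, h1, h.ne, e1, e2, not_lt.2 h.le]
  · subst h
    have h1 : (mid n).val = n := rfl
    by_cases e2 : ε' = mid n
    · simp [e2, bar_mid, h1]
    · simp [e2, bar_mid]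
  · have h1 : n < ε.val := h
    have hb := bar_ne ε h.ne'
    by_cases e1 : ε' = barC n ε
    · subst e1
      simp [h, h1, h.ne', hb, not_lt.2 h.le, not_lt.2 h1.le]
    · by_cases e2 : ε' = ε
      · subst e2; simp [h, h1, h.ne', hb.symm, not_lt.2 h.le, not_lt.2 h1.le]
      · simp [h, h.ne', e1, e2, not_lt.2 h.le]

end wts


section pfexp
variable {n L : ℕ}

/-- Horizontal configurations. -/
abbrev HH (n L : ℕ) := Fin (2*n) × Fin (L+1) → Col n

/-- row index of the pair -/
def hf (r : Fin (2*n)) : Fin n := ⟨r.val / 2, by have := r.isLt; omega⟩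

/-- Incoming color. -/
def jn (h : HH n L) (r : Fin (2*n)) (c : Fin L) : Col n :=
  if r.val % 2 = 0 then h (r, c.castSucc) else h (r, c.succ)
/-- Outgoing color. -/
def ln (h : HH n L) (r : Fin (2*n)) (c : Fin L) : Col n :=
  if r.val % 2 = 0 then h (r, c.succ) else h (r, c.castSucc)

/-- Change of vertical configuration along a row. -/
def rowinc (h : HH n L) (r : Fin (2*n)) : Idx n :=
  if r.val % 2 = 0 then -(incG n L (fun p => h (r, p))) else incG n L (fun p => h (r, p))

/-- Vertical configuration at a level. -/
def VV (h : HH n L) (v : ℕ) : Idx n := ∑ r : Fin (2*n), if v ≤ r.val then rowinc h r else 0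

theorem rowinc_apply (h : HH n L) (r : Fin (2*n)) (c : Fin L) :
    rowinc h r c.val = eZ n (jn h r c) - eZ n (ln h r c) := by
  have e : incG n L (fun p => h (r, p)) c.val = eZ n (h (r, c.succ)) - eZ n (h (r, c.castSucc)) := by
    simp only [incG, dif_pos c.isLt]; rfl
  by_cases hr : r.val % 2 = 0
  · simp only [rowinc, jn, ln, if_pos hr, Pi.neg_apply, e, neg_sub]
  · simp only [rowinc, jn, ln, if_neg hr, e]

theorem VV_last (h : HH n L) : VV h (2*n) = 0 := by
  unfold VV
  refine Finset.sum_eq_zero fun r _ => ?_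
  rw [if_neg (by have := r.isLt; omega)]

theorem VV_step (h : HH n L) (r : Fin (2*n)) : VV h r.val = VV h (r.val+1) + rowinc h r := by
  unfold VV
  have : rowinc h r = ∑ r' : Fin (2*n), if r' = r then rowinc h r' else 0 := by simp
  rw [this, ← Finset.sum_add_distrib]
  refine Finset.sum_congr rfl fun r' _ => ?_
  by_cases h1 : r' = r
  · subst h1; simp
  · have : r'.val ≠ r.val := fun h => h1 (Fin.ext h)
    simp only [if_neg h1, add_zero]
    congr 1
    simp only [eq_iff_iff]
    omega

theorem eV_cast (c k : Col n) : ((eV n c k : ℕ) : ℤ) = eZ n c k := by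
  unfold eV eZ
  split_ifs <;> simp

/-- Admissibility of all the vertices. -/
def admis (st : St n L) : Prop := ∀ (r : Fin (2*n)) (c : Fin L) (k : Col n),
  st.2 (r.succ, c) k + eV n (jn st.1 r c) k = st.2 (r.castSucc, c) k + eV n (ln st.1 r c) k

theorem admis_V (st : St n L) (h : admis st) (hb : ∀ c : Fin L, st.2 (Fin.last (2*n), c) = fun _ => 0)
    (v : Fin (2*n+1)) (c : Fin L) (k : Col n) : ((st.2 (v, c) k : ℕ) : ℤ) = VV st.1 v.val c.val k := by
  induction v using Fin.reverseInduction with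
  | last => rw [hb c]; simp [VV_last]
  | cast r ih =>
    have h1 := h r c k
    have h2 : ((st.2 (r.succ, c) k : ℕ) : ℤ) + eZ n (jn st.1 r c) k
        = (st.2 (r.castSucc, c) k : ℕ) + eZ n (ln st.1 r c) k := by
      rw [← eV_cast, ← eV_cast]; exact_mod_cast h1
    have h3 := congrFun (congrFun (VV_step st.1 r) c.val) k
    rw [Pi.add_apply, rowinc_apply, Pi.add_apply, Pi.sub_apply] at h3
    rw [Fin.val_castSucc, h3]
    rw [Fin.val_succ] at ih
    rw [← ih]
    linarith

/-- Weight of a vertex in a state. -/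
noncomputable def vw (q s : ℂ) (x : Fin n → ℂ) (st : St n L) (r : Fin (2*n)) (c : Fin L) : ℂ :=
  if r.val % 2 = 0 then
    MW n q s (x (hf r)) (st.2 (r.succ, c)) (st.1 (r, c.castSucc)) (st.2 (r.castSucc, c)) (st.1 (r, c.succ))
  else
    LW n q s (x (hf r)) (st.2 (r.succ, c)) (st.1 (r, c.succ)) (st.2 (r.castSucc, c)) (st.1 (r, c.castSucc))

theorem vw_ne (q s : ℂ) (x : Fin n → ℂ) (st : St n L) (r : Fin (2*n)) (c : Fin L)
    (h : vw q s x st r c ≠ 0) (k : Col n) :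
    st.2 (r.succ, c) k + eV n (jn st.1 r c) k = st.2 (r.castSucc, c) k + eV n (ln st.1 r c) k := by
  unfold vw at h
  unfold jn ln
  by_cases hr : r.val % 2 = 0
  · simp only [if_pos hr] at h ⊢
    unfold MW at h
    by_contra hk
    rw [if_neg (fun h' => hk (h' k))] at h
    exact h rfl
  · simp only [if_neg hr] at h ⊢
    unfold LW at h
    by_contra hk
    rw [if_neg (fun h' => hk (h' k))] at h
    exact h rfl

/-- Bottom row of a pair -/
def botR (i : Fin n) : Fin (2*n) := ⟨2 * i.val + 1, by have := i.isLt; omega⟩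
/-- Top row of a pair -/
def topR (i : Fin n) : Fin (2*n) := ⟨2 * i.val, by have := i.isLt; omega⟩

/-- Normalized vertex weight. -/
noncomputable def wV (q s : ℂ) (x : Fin n → ℂ) (h : HH n L) (r : Fin (2*n)) (c : Fin L) : ℂ :=
  if r.val % 2 = 0 then emN (x (hf r) / s) (Pk n q s (VV h (r.val+1) c)) (jn h r c) (ln h r c)
  else ellN (x (hf r) / s) (Pk n q s (VV h (r.val+1) c)) (jn h r c) (ln h r c)

/-- Cap product. -/
noncomputable def capP (ν t qh : ℂ) (x : Fin n → ℂ) (h : HH n L) : ℂ :=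
  ∏ i : Fin n, capW n ν t qh (x i) (h (botR i, 0)) (h (topR i, 0))

/-- Left and top boundary conditions for horizontal configurations. -/
def BH (σ : Equiv.Perm (Col n)) (μ : Fin n → ℤ) (h : HH n L) : Prop :=
  (∀ r : Fin (2*n), h (r, Fin.last L) = if r.val % 2 = 0 then mid n else σ (posC n (hf r))) ∧
  (∀ (c : Fin L) (k : Col n), VV h 0 c.val k = (topV n L μ c k : ℤ))

/-- vertex prefactor -/
noncomputable def preV (s : ℂ) (x : Fin n → ℂ) (r : Fin (2*n)) : ℂ :=
  if r.val % 2 = 0 then s^2 / (1 - s * x (hf r)) else 1 / (1 - s * x (hf r))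

/-- State attached to a horizontal configuration. -/
def gmap (h : HH n L) : St n L := (h, fun vc k => (VV h vc.1.val vc.2.val k).toNat)

open Classical in
theorem term_eq (q s ν t qh : ℂ) (x : Fin n → ℂ) (hq : q ≠ 0) (hs : s ≠ 0) (hsx : ∀ j, 1 - s * x j ≠ 0)
    (σ : Equiv.Perm (Col n)) (μ : Fin n → ℤ) (h : HH n L) :
    (if BC n L σ μ (gmap h) then stWt n L q s ν t qh x (gmap h) else 0) =
      if BH σ μ h then (∏ r : Fin (2*n), ∏ c : Fin L, preV s x r * wV q s x h r c) * capP ν t qh x h else 0 := by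
  have hst : stWt n L q s ν t qh x (gmap h)
      = (∏ r : Fin (2*n), ∏ c : Fin L, vw q s x (gmap h) r c) * capP ν t qh x h := rfl
  by_cases hpos : ∀ (v : Fin (2*n+1)) (c : Fin L) (k : Col n), 0 ≤ VV h v.val c.val k
  · have hcast : ∀ (v : Fin (2*n+1)) (c : Fin L) (k : Col n),
        (((gmap h).2 (v, c) k : ℕ) : ℤ) = VV h v.val c.val k := by
      intro v c k
      exact Int.toNat_of_nonneg (hpos v c k)
    have hBC : BC n L σ μ (gmap h) ↔ BH σ μ h := by
      unfold BC BH
      refine and_congr Iff.rfl ⟨?_, ?_⟩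
      · rintro ⟨h1, -⟩ c k
        have := hcast 0 c k
        rw [h1 c] at this
        exact this.symm
      · intro h1
        refine ⟨fun c => ?_, fun c => ?_⟩
        · funext k
          have := hcast 0 c k
          have e : VV h (0 : Fin (2*n+1)).val c.val k = _ := h1 c k
          rw [e] at this
          exact_mod_cast this
        · funext k
          have := hcast (Fin.last _) c k
          rw [Fin.val_last, VV_last] at this
          change _ = (0 : ℤ) at this
          exact_mod_cast this
    have hadm : admis (gmap h) := by
      intro r c k
      have h3 := congrFun (congrFun (VV_step h r) c.val) k
      rw [Pi.add_apply, rowinc_apply, Pi.add_apply, Pi.sub_apply] at h3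
      have h1 := hcast r.succ c k
      have h2 := hcast r.castSucc c k
      rw [Fin.val_succ] at h1
      rw [Fin.val_castSucc] at h2
      have : (((gmap h).2 (r.succ, c) k : ℕ) : ℤ) + (eV n (jn h r c) k : ℕ)
          = ((gmap h).2 (r.castSucc, c) k : ℕ) + (eV n (ln h r c) k : ℕ) := by
        rw [h1, h2, eV_cast, eV_cast, h3]; ring
      exact_mod_cast this
    have hvw : ∀ r c, vw q s x (gmap h) r c = preV s x r * wV q s x h r c := by
      intro r c
      have hI : ivec n ((gmap h).2 (r.succ, c)) = VV h (r.val+1) c.val := by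
        funext k
        have := hcast r.succ c k
        rwa [Fin.val_succ] at this
      have ha := hadm r c
      unfold vw preV wV
      by_cases hr : r.val % 2 = 0
      · simp only [if_pos hr, jn, ln] at ha ⊢
        rw [MW_eq q s _ hq hs (hsx _) _ _ _ _ ha, hI]
        change s^2 * _ / _ = s^2 / _ * _
        rw [mul_div_right_comm]
        rfl
      · simp only [if_neg hr, jn, ln] at ha ⊢
        rw [LW_eq q s _ hq hs (hsx _) _ _ _ _ ha, hI]
        rw [one_div, inv_mul_eq_div]
        rfl
    rw [hst]
    simp only [hvw, hBC]
  · have hL0 : ¬ (BC n L σ μ (gmap h) ∧ stWt n L q s ν t qh x (gmap h) ≠ 0) := by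
      rintro ⟨hb, hw⟩
      apply hpos
      intro v c k
      have hadm : admis (gmap h) := by
        intro r c k
        apply vw_ne q s x
        rw [hst] at hw
        have h1 := left_ne_zero_of_mul hw
        exact Finset.prod_ne_zero_iff.1 (Finset.prod_ne_zero_iff.1 h1 r (Finset.mem_univ _)) c (Finset.mem_univ _)
      have := admis_V (gmap h) hadm hb.2.2 v c k
      change _ = VV h v.val c.val k at this
      rw [← this]
      positivity
    have hR0 : (∏ r : Fin (2*n), ∏ c : Fin L, preV s x r * wV q s x h r c) = 0 := by
      by_contra hne
      apply hpos
      intro v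
      induction v using Fin.reverseInduction with
      | last => intro c k; simp [VV_last]
      | cast r ih =>
        intro c k
        have hw : wV q s x h r c ≠ 0 := right_ne_zero_of_mul
          (Finset.prod_ne_zero_iff.1 (Finset.prod_ne_zero_iff.1 hne r (Finset.mem_univ _)) c (Finset.mem_univ _))
        have h3 := congrFun (congrFun (VV_step h r) c.val) k
        rw [Pi.add_apply, rowinc_apply, Pi.add_apply, Pi.sub_apply] at h3
        rw [Fin.val_castSucc, h3]
        have h4 := ih c k
        rw [Fin.val_succ] at h4
        by_contra hneg
        have hz : ln h r c ≠ mid n ∧ k = ln h r c ∧ jn h r c ≠ ln h r c ∧ VV h (r.val+1) c.val k = 0 := by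
          have h5 : 0 ≤ eZ n (jn h r c) k := by unfold eZ; split_ifs <;> simp
          by_cases hk : ln h r c ≠ mid n ∧ k = ln h r c
          · have h6 : eZ n (ln h r c) k = 1 := by unfold eZ; rw [if_pos hk]
            refine ⟨hk.1, hk.2, ?_, by omega⟩
            intro h7
            rw [h7] at hneg
            omega
          · have h6 : eZ n (ln h r c) k = 0 := by unfold eZ; rw [if_neg hk]
            omega
        obtain ⟨z1, z2, z3, z4⟩ := hz
        rw [z2] at z4
        apply hw
        unfold wV
        rw [ellN_zero q s _ _ _ _ z1 z4 z3, emN_zero q s _ _ _ _ z1 z4 z3, ite_self]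
    rw [hR0, zero_mul, ite_self]
    by_cases hb : BC n L σ μ (gmap h)
    · rw [if_pos hb]
      by_contra hw
      exact hL0 ⟨hb, hw⟩
    · rw [if_neg hb]

open Classical in
theorem pf_sum (q s ν t qh : ℂ) (x : Fin n → ℂ) (hq : q ≠ 0) (hs : s ≠ 0) (hsx : ∀ j, 1 - s * x j ≠ 0)
    (σ : Equiv.Perm (Col n)) (μ : Fin n → ℤ) :
    pf n L q s ν t qh x σ μ = ∑ h : HH n L, if BH σ μ h then
      (∏ r : Fin (2*n), ∏ c : Fin L, preV s x r * wV q s x h r c) * capP ν t qh x h else 0 := by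
  have e : pf n L q s ν t qh x σ μ
      = ∑ᶠ st : St n L, if BC n L σ μ st then stWt n L q s ν t qh x st else 0 := by
    unfold pf
    refine finsum_congr fun st => ?_
    rw [finsum_eq_if]
    rfl
  rw [e, finsum_eq_finsetSum_of_support_subset (s := Finset.univ.image (gmap (n := n) (L := L)))]
  · rw [Finset.sum_image]
    · exact Finset.sum_congr rfl fun h _ => term_eq q s ν t qh x hq hs hsx σ μ h
    · intro h _ h' _ heq
      exact congrArg Prod.fst heq
  · intro st hst
    rw [Function.mem_support] at hst
    have hb : BC n L σ μ st := by
      by_contra hb; rw [if_neg hb] at hst; exact hst rfl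
    rw [if_pos hb] at hst
    have hadm : admis st := by
      intro r c k
      apply vw_ne q s x
      have hst' : (∏ r : Fin (2*n), ∏ c : Fin L, vw q s x st r c) * capP ν t qh x st.1 ≠ 0 := hst
      have h1 := left_ne_zero_of_mul hst'
      exact Finset.prod_ne_zero_iff.1 (Finset.prod_ne_zero_iff.1 h1 r (Finset.mem_univ _)) c (Finset.mem_univ _)
    simp only [Finset.coe_image, Finset.coe_univ, Set.image_univ, Set.mem_range]
    refine ⟨st.1, ?_⟩
    refine Prod.ext rfl ?_
    funext vc k
    have := admis_V st hadm hb.2.2 vc.1 vc.2 k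
    change (VV st.1 vc.1.val vc.2.val k).toNat = _
    rw [← this]
    simp

end pfexp


theorem prod_two {M : Type*} [CommMonoid M] (n : ℕ) (F : Fin (2*n) → M) :
    ∏ r, F r = ∏ i : Fin n, F (botR i) * F (topR i) := by
  rw [← Equiv.prod_comp (finProdFinEquiv.trans (finCongr (mul_comm n 2))) F, Fintype.prod_prod_type]
  refine Finset.prod_congr rfl fun i _ => ?_
  rw [Fin.prod_univ_two, mul_comm]
  congr 1
  · congr 1
    apply Fin.ext
    simp [botR, finProdFinEquiv]
    omega
  · congr 1
    apply Fin.ext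
    simp [topR, finProdFinEquiv]

theorem sum_two {M : Type*} [AddCommMonoid M] (n : ℕ) (F : Fin (2*n) → M) :
    ∑ r, F r = ∑ i : Fin n, (F (botR i) + F (topR i)) := by
  rw [← Equiv.sum_comp (finProdFinEquiv.trans (finCongr (mul_comm n 2))) F, Fintype.sum_prod_type]
  refine Finset.sum_congr rfl fun i _ => ?_
  rw [Fin.sum_univ_two, add_comm]
  congr 1
  · congr 1
    apply Fin.ext
    simp [botR, finProdFinEquiv]
    omega
  · congr 1
    apply Fin.ext
    simp [topR, finProdFinEquiv]

theorem Zrec_exp {n : ℕ} {B : Type*} [Fintype B] (D : ℕ → Module.End ℂ (V0 n)) (w : ℕ → Idx n → B → ℂ)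
    (inc : B → Idx n) (N : ℕ)
    (hD : ∀ k < N, ∀ ψ I, D k ψ I = ∑ b, w k I b * ψ (I + inc b)) (ψ : V0 n) (I : Idx n) :
    Zrec D N ψ I = ∑ H : Fin N → B,
      (∏ k : Fin N, w k (I + ∑ j : Fin N, if k.val + 1 ≤ j.val then inc (H j) else 0) (H k))
        * ψ (I + ∑ j : Fin N, inc (H j)) := by
  induction N generalizing I with
  | zero => simp [Zrec]
  | succ N ih =>
    rw [← Equiv.sum_comp (Fin.snocEquiv (fun _ : Fin (N+1) => B)), Fintype.sum_prod_type]
    rw [Zrec, Module.End.mul_apply, hD N (by omega)]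
    refine Finset.sum_congr rfl fun b _ => ?_
    rw [ih (fun k hk => hD k (by omega)), Finset.mul_sum]
    refine Finset.sum_congr rfl fun H _ => ?_
    have es : (Fin.snocEquiv (fun _ : Fin (N+1) => B)) (b, H) = (Fin.snoc H b : Fin (N+1) → B) := rfl
    rw [es]
    simp only [Fin.prod_univ_castSucc, Fin.sum_univ_castSucc, Fin.snoc_castSucc (α := fun _ => B),
      Fin.snoc_last (α := fun _ => B), Fin.val_castSucc, Fin.val_last]
    have e1 : ∀ k : Fin N, (if k.val + 1 ≤ N then inc b else 0) = inc b := fun k => by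
      rw [if_pos (by have := k.isLt; omega)]
    have e2 : ∀ k : Fin N, (if N + 1 ≤ k.val then inc (H k) else 0) = 0 := fun k => by
      rw [if_neg (by have := k.isLt; omega)]
    have e3 : ∀ J : Idx n, I + (J + inc b) = I + inc b + J := fun J => by abel
    simp only [e1, e2, e3, if_neg (show ¬ (N + 1 ≤ N) by omega), Finset.sum_const_zero, add_zero]
    ring

section zz
variable {n L : ℕ}

/-- Pair rows. -/
def pairEquiv (n L : ℕ) : (Fin n → (Fin (L+1) → Col n) × (Fin (L+1) → Col n)) ≃ HH n L where
  toFun H := fun rp => if rp.1.val % 2 = 0 then (H (hf rp.1)).2 rp.2 else (H (hf rp.1)).1 rp.2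
  invFun h := fun i => (fun p => h (botR i, p), fun p => h (topR i, p))
  left_inv H := by
    funext i
    have e1 : hf (botR i) = i := by apply Fin.ext; simp [hf, botR]; omega
    have e2 : hf (topR i) = i := by apply Fin.ext; simp [hf, topR]
    have e3 : (botR i).val % 2 ≠ 0 := by simp [botR]
    have e4 : (topR i).val % 2 = 0 := by simp [topR]
    simp only [e1, e2, e4, if_true, if_neg e3]
  right_inv h := by
    funext ⟨r, p⟩
    by_cases hr : r.val % 2 = 0
    · have : topR (hf r) = r := by apply Fin.ext; simp [hf, topR]; omega
      simp only [if_pos hr, this]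
    · have : botR (hf r) = r := by apply Fin.ext; simp [hf, botR]; omega
      simp only [if_neg hr, this]

/-- The sequence of double row operators. -/
noncomputable def Dseq (n L : ℕ) (q s t : ℂ) (p x : Fin n → ℂ) (σ : Fin n → Col n) (k : ℕ) :
    Module.End ℂ (V0 n) :=
  if h : k < n then Dop n q s t (p ⟨k, h⟩) (x ⟨k, h⟩) L (σ ⟨k, h⟩) else 1

open Classical in
/-- Indicator of the top boundary. -/
noncomputable def topI (n L : ℕ) (μ : Fin n → ℤ) : V0 n := fun I =>
  if ∀ (c : Fin L) (k : Col n), I c.val k = (topV n L μ c k : ℤ) then 1 else 0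

theorem hf_bot (i : Fin n) : hf (botR i) = i := by apply Fin.ext; simp [hf, botR]; omega
theorem hf_top (i : Fin n) : hf (topR i) = i := by apply Fin.ext; simp [hf, topR]
theorem bot_odd (i : Fin n) : ¬ ((botR i).val % 2 = 0) := by simp [botR]
theorem top_even (i : Fin n) : (topR i).val % 2 = 0 := by simp [topR]

theorem VV_pair (h : HH n L) (i : Fin n) : VV h (2 * i.val + 2) =
    ∑ j : Fin n, if i.val + 1 ≤ j.val then
      incG n L (fun p => h (botR j, p)) - incG n L (fun p => h (topR j, p)) else 0 := by
  unfold VV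
  rw [sum_two]
  refine Finset.sum_congr rfl fun j _ => ?_
  simp only [rowinc, if_pos (top_even j), if_neg (bot_odd j)]
  by_cases hj : i.val + 1 ≤ j.val
  · rw [if_pos hj, if_pos (by simp [botR]; omega), if_pos (by simp [topR]; omega)]; abel
  · rw [if_neg hj, if_neg (by simp [botR]; omega), if_neg (by simp [topR]; omega)]; abel

theorem VV_zero (h : HH n L) : VV h 0 =
    ∑ j : Fin n, (incG n L (fun p => h (botR j, p)) - incG n L (fun p => h (topR j, p))) := by
  unfold VV
  rw [sum_two]
  refine Finset.sum_congr rfl fun j _ => ?_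
  simp only [rowinc, if_pos (top_even j), if_neg (bot_odd j), Nat.zero_le, if_true]
  abel

open Classical in
theorem ZZ_sum (q s ν t qh : ℂ) (x : Fin n → ℂ) (σ : Equiv.Perm (Col n)) (μ : Fin n → ℤ) :
    Zrec (Dseq n L q s t (fun j => phiF ν t (qh * (x j)⁻¹)) x (fun j => σ (posC n j))) n (topI n L μ) 0
     = ∑ h : HH n L, if BH σ μ h then
      (∏ r : Fin (2*n), ∏ c : Fin L, wV q s x h r c) * capP ν t qh x h else 0 := by
  rw [Zrec_exp (B := (Fin (L+1) → Col n) × (Fin (L+1) → Col n)) _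
    (fun k I b => if h : k < n then wD n q s t (phiF ν t (qh * (x ⟨k, h⟩)⁻¹)) (x ⟨k, h⟩) L (σ (posC n ⟨k, h⟩))
      I b.1 b.2 else 0) (fun b => incG n L b.1 - incG n L b.2) n]
  · rw [← Equiv.sum_comp (pairEquiv n L).symm]
    refine Finset.sum_congr rfl fun h _ => ?_
    have e0 : ∀ i, (pairEquiv n L).symm h i = (fun p => h (botR i, p), fun p => h (topR i, p)) := fun i => rfl
    simp only [e0, zero_add, ← VV_pair, ← VV_zero, Fin.is_lt, dif_pos, Fin.eta]
    by_cases hl : ∀ r : Fin (2*n), h (r, Fin.last L) = if r.val % 2 = 0 then mid n else σ (posC n (hf r))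
    · have w1 : ∀ i : Fin n, wD n q s t (phiF ν t (qh * (x i)⁻¹)) (x i) L (σ (posC n i))
          (VV h (2 * i.val + 2)) (fun p => h (botR i, p)) (fun p => h (topR i, p))
          = ((∏ c : Fin L, wV q s x h (botR i) c) * (∏ c : Fin L, wV q s x h (topR i) c))
            * capW n ν t qh (x i) (h (botR i, 0)) (h (topR i, 0)) := by
        intro i
        unfold wD
        have c1 := hl (botR i)
        have c2 := hl (topR i)
        rw [if_neg (bot_odd i), hf_bot] at c1
        rw [if_pos (top_even i)] at c2
        rw [if_pos ⟨c1, c2⟩, capW_eq]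
        have v1 : VV h (2 * i.val + 2) + incG n L (fun p => h (botR i, p)) = VV h (2 * i.val + 1) := by
          have := VV_step h (botR i)
          simp only [rowinc, if_neg (bot_odd i)] at this
          exact this.symm
        rw [v1]
        have v2 : ∀ c : Fin L, wV q s x h (botR i) c
            = ellN (x i / s) (Pk n q s (VV h (2 * i.val + 2) c)) (h (botR i, c.succ)) (h (botR i, c.castSucc)) := by
          intro c
          simp only [wV, jn, ln, if_neg (bot_odd i), hf_bot]
          rfl
        have v3 : ∀ c : Fin L, wV q s x h (topR i) c
            = emN (x i / s) (Pk n q s (VV h (2 * i.val + 1) c)) (h (topR i, c.castSucc)) (h (topR i, c.succ)) := by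
          intro c
          simp only [wV, jn, ln, if_pos (top_even i), hf_top]
          rfl
        simp only [v2, v3]
        ring
      simp only [w1]
      rw [Finset.prod_mul_distrib, ← prod_two n (fun r => ∏ c : Fin L, wV q s x h r c)]
      change _ * capP ν t qh x h * _ = _
      unfold topI BH
      by_cases ht : ∀ (c : Fin L) (k : Col n), VV h 0 c.val k = (topV n L μ c k : ℤ)
      · rw [if_pos ht, if_pos ⟨hl, ht⟩, mul_one]
      · rw [if_neg ht, if_neg (fun h' => ht h'.2), mul_zero]
    · rw [if_neg (fun h' => hl h'.1)]
      push Not at hl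
      obtain ⟨r, hr⟩ := hl
      rw [Finset.prod_eq_zero (Finset.mem_univ (hf r)), zero_mul]
      unfold wD
      rw [if_neg]
      rintro ⟨c1, c2⟩
      apply hr
      by_cases h0 : r.val % 2 = 0
      · have : topR (hf r) = r := by apply Fin.ext; simp [hf, topR]; omega
        rw [if_pos h0, ← c2, this]
      · have : botR (hf r) = r := by apply Fin.ext; simp [hf, botR]; omega
        rw [if_neg h0, ← c1, this]
  · intro k hk ψ I
    simp only [Dseq, dif_pos hk]
    rw [Dop_exp]

open Classical in
theorem pf_ZZ (q s ν t qh : ℂ) (x : Fin n → ℂ) (hq : q ≠ 0) (hs : s ≠ 0) (hsx : ∀ j, 1 - s * x j ≠ 0)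
    (σ : Equiv.Perm (Col n)) (μ : Fin n → ℤ) :
    pf n L q s ν t qh x σ μ = (∏ j, (s^2 / (1 - s * x j)^2) ^ L) *
      Zrec (Dseq n L q s t (fun j => phiF ν t (qh * (x j)⁻¹)) x (fun j => σ (posC n j))) n (topI n L μ) 0 := by
  rw [pf_sum q s ν t qh x hq hs hsx, ZZ_sum, Finset.mul_sum]
  refine Finset.sum_congr rfl fun h _ => ?_
  rw [mul_ite, mul_zero]
  congr 1
  simp only [Finset.prod_mul_distrib, Finset.prod_const, Finset.card_univ, Fintype.card_fin]
  rw [prod_two n (fun r => preV s x r ^ L)]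
  have : ∀ i, preV s x (botR i) ^ L * preV s x (topR i) ^ L = (s^2 / (1 - s * x i)^2) ^ L := by
    intro i
    have := hsx i
    rw [← mul_pow]
    congr 1
    simp only [preV, if_neg (bot_odd i), if_pos (top_even i), hf_bot, hf_top]
    field_simp
  simp only [this]
  ring

end zz


section len
variable {n : ℕ}

/-- Weights of the pairs in the length statistic. -/
def cwt (n : ℕ) (a b : Col n) : ℤ := if a = mid n ∨ b = mid n then 1 else 2

/-- Four times the length. -/
def stat4 (n : ℕ) (σ : Equiv.Perm (Col n)) : ℤ :=
  ∑ a : Col n, ∑ b : Col n, cwt n a b * (if a < b then 1 else 0) * (if σ b < σ a then 1 else 0)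

theorem stat4_mul (σ τ : Equiv.Perm (Col n)) (hτ : τ (mid n) = mid n) (hi : ∀ a, τ (τ a) = a) :
    stat4 n (σ * τ) = stat4 n σ + ∑ a : Col n, ∑ b : Col n,
      cwt n a b * ((if τ a < τ b then 1 else 0) - (if a < b then 1 else 0)) * (if σ b < σ a then 1 else 0) := by
  have e : stat4 n (σ * τ) = ∑ a : Col n, ∑ b : Col n,
      cwt n a b * (if τ a < τ b then 1 else 0) * (if σ b < σ a then 1 else 0) := by
    unfold stat4
    rw [← Equiv.sum_comp τ]
    refine Finset.sum_congr rfl fun a _ => ?_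
    rw [← Equiv.sum_comp τ]
    refine Finset.sum_congr rfl fun b _ => ?_
    have hm : ∀ c, τ c = mid n ↔ c = mid n := fun c => by
      constructor
      · intro h; rw [← hi c, h, hτ]
      · rintro rfl; exact hτ
    simp only [Equiv.Perm.mul_apply, hi, cwt, hm]
  rw [e]
  unfold stat4
  simp only [← Finset.sum_add_distrib]
  refine Finset.sum_congr rfl fun a _ => Finset.sum_congr rfl fun b _ => ?_
  ring

/-- Elementary antisymmetric function. -/
def el (n : ℕ) (p r a b : Col n) : ℤ := (if a = r ∧ b = p then 1 else 0) - (if a = p ∧ b = r then 1 else 0)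

theorem el_sum (p r : Col n) (F : Col n → Col n → ℤ) :
    ∑ a : Col n, ∑ b : Col n, el n p r a b * F a b = F r p - F p r := by
  unfold el
  simp only [sub_mul, Finset.sum_sub_distrib, ite_and, ite_mul, one_mul, zero_mul, Finset.sum_ite_eq',
    Finset.mem_univ, if_true]
  simp

theorem swap_val {m : ℕ} (p r a : Fin m) :
    (Equiv.swap p r a).val = if a.val = p.val then r.val else if a.val = r.val then p.val else a.val := by
  rw [Equiv.swap_apply_def]
  simp only [Fin.ext_iff]
  split_ifs <;> rfl

theorem siB_val (i i' : Fin n) (h : i'.val = i.val + 1) (a : Col n) :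
    (siB n i i' a).val = if a.val = i.val then i.val + 1 else if a.val = i.val + 1 then i.val
      else if a.val = 2 * n - i.val then 2 * n - i.val - 1 else if a.val = 2 * n - i.val - 1 then 2 * n - i.val
      else a.val := by
  have h1 := i'.isLt
  have h2 := a.isLt
  unfold siB
  simp only [Equiv.trans_apply, swap_val, posC, barC]
  split_ifs <;> omega

theorem snB_val (hn : 0 < n) (a : Col n) :
    (snB n a).val = if a.val = n - 1 then n + 1 else if a.val = n + 1 then n - 1 else a.val := by
  unfold snB
  simp only [Equiv.swap_apply_def, Fin.ext_iff, lastCol, barC]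
  split_ifs <;> simp_all <;> omega

theorem siB_diff (i i' : Fin n) (h : i'.val = i.val + 1) (a b : Col n) :
    cwt n a b * ((if siB n i i' a < siB n i i' b then 1 else 0) - (if a < b then 1 else 0))
      = 2 * el n (posC n i) (posC n i') a b + 2 * el n (barC n (posC n i')) (barC n (posC n i)) a b := by
  have h1 := i'.isLt
  have ha := a.isLt
  have hb := b.isLt
  simp only [cwt, el, Fin.lt_def, siB_val i i' h, Fin.ext_iff, posC, barC, mid, h]
  have ca : a.val = i.val ∨ a.val = i.val + 1 ∨ a.val = 2 * n - i.val ∨ a.val = 2 * n - i.val - 1 ∨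
    (a.val ≠ i.val ∧ a.val ≠ i.val + 1 ∧ a.val ≠ 2 * n - i.val ∧ a.val ≠ 2 * n - i.val - 1) := by omega
  have cb : b.val = i.val ∨ b.val = i.val + 1 ∨ b.val = 2 * n - i.val ∨ b.val = 2 * n - i.val - 1 ∨
    (b.val ≠ i.val ∧ b.val ≠ i.val + 1 ∧ b.val ≠ 2 * n - i.val ∧ b.val ≠ 2 * n - i.val - 1) := by omega
  rcases ca with ca | ca | ca | ca | ca <;> rcases cb with cb | cb | cb | cb | cb <;>
    simp (disch := omega) only [if_pos, if_neg] <;> (try split_ifs) <;> first | omega | norm_num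

theorem snB_diff (hn : 0 < n) (a b : Col n) :
    cwt n a b * ((if snB n a < snB n b then 1 else 0) - (if a < b then 1 else 0))
      = el n (lastCol n) (mid n) a b + el n (mid n) (barC n (lastCol n)) a b
        + 2 * el n (lastCol n) (barC n (lastCol n)) a b := by
  have ha := a.isLt
  have hb := b.isLt
  simp only [cwt, el, Fin.lt_def, snB_val hn, Fin.ext_iff, lastCol, barC, mid]
  have ca : a.val = n - 1 ∨ a.val = n ∨ a.val = n + 1 ∨ 
    (a.val ≠ n - 1 ∧ a.val ≠ n ∧ a.val ≠ n + 1) := by omega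
  have cb : b.val = n - 1 ∨ b.val = n ∨ b.val = n + 1 ∨ 
    (b.val ≠ n - 1 ∧ b.val ≠ n ∧ b.val ≠ n + 1) := by omega
  rcases ca with ca | ca | ca | ca <;> rcases cb with cb | cb | cb | cb <;>
    simp (disch := omega) only [if_pos, if_neg] <;> (try split_ifs) <;> first | omega | norm_num

theorem siB_mid (i i' : Fin n) (h : i'.val = i.val + 1) : siB n i i' (mid n) = mid n := by
  have h1 := i'.isLt
  apply Fin.ext
  rw [siB_val i i' h]
  have e : (mid n).val = n := rfl
  rw [if_neg (by omega), if_neg (by omega), if_neg (by omega), if_neg (by omega)]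

theorem siB_inv (i i' : Fin n) (h : i'.val = i.val + 1) (a : Col n) : siB n i i' (siB n i i' a) = a := by
  have h1 := i'.isLt
  have h2 := a.isLt
  apply Fin.ext
  simp only [siB_val i i' h]
  split_ifs <;> omega

theorem siB_bar (i i' : Fin n) (h : i'.val = i.val + 1) (a : Col n) :
    siB n i i' (barC n a) = barC n (siB n i i' a) := by
  have h1 := i'.isLt
  have h2 := a.isLt
  apply Fin.ext
  simp only [siB_val i i' h, barC]
  split_ifs <;> omega

theorem snB_mid (hn : 0 < n) : snB n (mid n) = mid n := by
  apply Fin.ext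
  rw [snB_val hn]
  have e : (mid n).val = n := rfl
  rw [if_neg (by omega), if_neg (by omega)]

theorem snB_inv (hn : 0 < n) (a : Col n) : snB n (snB n a) = a := by
  apply Fin.ext
  simp only [snB_val hn]
  split_ifs <;> omega

theorem snB_bar (hn : 0 < n) (a : Col n) : snB n (barC n a) = barC n (snB n a) := by
  have h2 := a.isLt
  apply Fin.ext
  simp only [snB_val hn, barC]
  split_ifs <;> omega

theorem bar_lt (a b : Col n) : barC n a < barC n b ↔ b < a := by
  have h1 := a.isLt
  have h2 := b.isLt
  simp only [Fin.lt_def, barC]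
  omega

theorem sig_mid (σ : Equiv.Perm (Col n)) (hσ : ∀ k, σ (barC n k) = barC n (σ k)) : σ (mid n) = mid n := by
  have h := hσ (mid n)
  have h0 : barC n (mid n) = mid n := by
    apply Fin.ext
    simp only [barC, mid]
    omega
  rw [h0] at h
  have h2 := (σ (mid n)).isLt
  have := congrArg Fin.val h
  apply Fin.ext
  simp only [barC, mid] at *
  omega

/-- Indicator of descents. -/
def inv01 (σ : Equiv.Perm (Col n)) (a b : Col n) : ℤ := if σ b < σ a then 1 else 0

theorem stat4_siB (σ : Equiv.Perm (Col n)) (hσ : ∀ k, σ (barC n k) = barC n (σ k))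
    (i i' : Fin n) (h : i'.val = i.val + 1) :
    stat4 n (σ * siB n i i') = stat4 n σ + 4 * (if σ (posC n i) < σ (posC n i') then 1 else -1) := by
  rw [stat4_mul σ _ (siB_mid i i' h) (siB_inv i i' h)]
  simp only [siB_diff i i' h, add_mul, mul_assoc, Finset.sum_add_distrib, ← Finset.mul_sum]
  have e1 := el_sum (posC n i) (posC n i') (inv01 σ)
  have e2 := el_sum (barC n (posC n i')) (barC n (posC n i)) (inv01 σ)
  unfold inv01 at e1 e2
  rw [e1, e2]
  simp only [hσ, bar_lt]
  have hne : σ (posC n i) ≠ σ (posC n i') := by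
    intro e
    have := congrArg Fin.val (σ.injective e)
    simp only [posC] at this
    omega
  rcases lt_or_gt_of_ne hne with hh | hh
  · simp [hh, hh.not_gt]
  · simp [hh, hh.not_gt]

theorem stat4_snB (hn : 0 < n) (σ : Equiv.Perm (Col n)) (hσ : ∀ k, σ (barC n k) = barC n (σ k)) :
    stat4 n (σ * snB n) = stat4 n σ + 4 * (if σ (lastCol n) < σ (mid n) then 1 else -1) := by
  rw [stat4_mul σ _ (snB_mid hn) (snB_inv hn)]
  simp only [snB_diff hn, add_mul, mul_assoc, Finset.sum_add_distrib, ← Finset.mul_sum]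
  have e1 := el_sum (lastCol n) (mid n) (inv01 σ)
  have e2 := el_sum (mid n) (barC n (lastCol n)) (inv01 σ)
  have e3 := el_sum (lastCol n) (barC n (lastCol n)) (inv01 σ)
  unfold inv01 at e1 e2 e3
  rw [e1, e2, e3]
  have hne : σ (lastCol n) ≠ σ (mid n) := by
    intro e
    have := congrArg Fin.val (σ.injective e)
    simp only [lastCol, mid] at this
    omega
  rw [sig_mid σ hσ] at hne ⊢
  have k1 : barC n (σ (lastCol n)) < mid n ↔ mid n < σ (lastCol n) := by
    have := (σ (lastCol n)).isLt
    simp only [Fin.lt_def, barC, mid]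
    omega
  have k2 : mid n < barC n (σ (lastCol n)) ↔ σ (lastCol n) < mid n := by
    have := (σ (lastCol n)).isLt
    simp only [Fin.lt_def, barC, mid]
    omega
  have k3 : barC n (σ (lastCol n)) < σ (lastCol n) ↔ mid n < σ (lastCol n) := by
    have := (σ (lastCol n)).isLt
    simp only [Fin.lt_def, barC, mid]
    omega
  have k4 : σ (lastCol n) < barC n (σ (lastCol n)) ↔ σ (lastCol n) < mid n := by
    have := (σ (lastCol n)).isLt
    simp only [Fin.lt_def, barC, mid]
    omega
  simp only [hσ, k1, k2, k3, k4]
  rcases lt_or_gt_of_ne hne with hh | hh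
  · simp [hh, hh.not_gt]
  · simp [hh, hh.not_gt]

theorem stat4_one : stat4 n 1 = 0 := by
  unfold stat4
  refine Finset.sum_eq_zero fun a _ => Finset.sum_eq_zero fun b _ => ?_
  simp only [Equiv.Perm.one_apply]
  by_cases h : a < b
  · simp [h, h.not_gt]
  · simp [h]

theorem stat4_nonneg (σ : Equiv.Perm (Col n)) : 0 ≤ stat4 n σ := by
  unfold stat4
  refine Finset.sum_nonneg fun a _ => Finset.sum_nonneg fun b _ => ?_
  unfold cwt
  split_ifs <;> norm_num

/-- Words stay in the hyperoctahedral group and have length at least the statistic. -/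
theorem word_bound (hn : 0 < n) (w : List (Equiv.Perm (Col n))) :
    (∀ g ∈ w, g ∈ gensB n) → (∀ k, w.prod (barC n k) = barC n (w.prod k)) ∧ stat4 n w.prod ≤ 4 * w.length := by
  induction w using List.reverseRecOn with
  | nil => intro _; simp [stat4_one]
  | append_singleton w g ih =>
    intro h
    obtain ⟨h1, h2⟩ := ih (fun g hg => h g (by simp [hg]))
    have hg := h g (by simp)
    simp only [List.prod_append, List.prod_singleton, List.length_append, List.length_singleton]
    rcases hg with ⟨i, i', hi, rfl⟩ | rfl
    · refine ⟨fun k => by simp only [Equiv.Perm.mul_apply, siB_bar i i' hi, h1], ?_⟩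
      rw [stat4_siB _ h1 i i' hi]
      push_cast
      split_ifs <;> linarith
    · refine ⟨fun k => by simp only [Equiv.Perm.mul_apply, snB_bar hn, h1], ?_⟩
      rw [stat4_snB hn _ h1]
      push_cast
      split_ifs <;> linarith

theorem no_desc (hn : 0 < n) (σ : Equiv.Perm (Col n)) (hσ : ∀ k, σ (barC n k) = barC n (σ k))
    (h1 : ∀ i i' : Fin n, i'.val = i.val + 1 → σ (posC n i) < σ (posC n i'))
    (h2 : σ (lastCol n) < σ (mid n)) : σ = 1 := by
  have hm : StrictMono (σ : Fin (2 * n + 1) → Fin (2 * n + 1)) := by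
    rw [Fin.strictMono_iff_lt_succ]
    intro k
    have hk := k.isLt
    rcases lt_trichotomy (k.val + 1) n with hc | hc | hc
    · exact h1 ⟨k.val, by omega⟩ ⟨k.val + 1, hc⟩ rfl
    · have e1 : k.castSucc = lastCol n := by
        apply Fin.ext; simp only [lastCol, Fin.val_castSucc]; omega
      have e2 : k.succ = mid n := by
        apply Fin.ext; simp only [mid, Fin.val_succ]; omega
      rw [e1, e2]; exact h2
    · have key : σ (barC n k.succ) < σ (barC n k.castSucc) := by
        by_cases hc' : k.val = n
        · have e1 : barC n k.succ = lastCol n := by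
            apply Fin.ext; simp only [lastCol, barC, Fin.val_succ]; omega
          have e2 : barC n k.castSucc = mid n := by
            apply Fin.ext; simp only [mid, barC, Fin.val_castSucc]; omega
          rw [e1, e2]; exact h2
        · have e1 : barC n k.succ = posC n ⟨2 * n - k.val - 1, by omega⟩ := by
            apply Fin.ext; simp only [posC, barC, Fin.val_succ]; omega
          have e2 : barC n k.castSucc = posC n ⟨2 * n - k.val, by omega⟩ := by
            apply Fin.ext; simp only [posC, barC, Fin.val_castSucc]
          rw [e1, e2]; exact h1 _ _ (by simp only; omega)
      rw [hσ, hσ, bar_lt] at key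
      exact key
  have : (σ : Fin (2 * n + 1) → Fin (2 * n + 1)) = id := by
    apply (StrictMono.range_inj hm strictMono_id).1
    simp [σ.surjective.range_eq]
  ext k
  rw [this]
  rfl

theorem word_exists (hn : 0 < n) (m : ℕ) : ∀ (σ : Equiv.Perm (Col n)), (∀ k, σ (barC n k) = barC n (σ k)) →
    stat4 n σ ≤ 4 * m → ∃ w : List (Equiv.Perm (Col n)), (∀ g ∈ w, g ∈ gensB n) ∧ w.prod = σ ∧
      4 * (w.length : ℤ) = stat4 n σ := by
  induction m with
  | zero =>
    intro σ hσ h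
    refine ⟨[], by simp, ?_, ?_⟩
    · symm
      apply no_desc hn σ hσ
      · intro i i' hi
        by_contra hc
        have e := stat4_siB σ hσ i i' hi
        rw [if_neg hc] at e
        have := stat4_nonneg (σ * siB n i i')
        push_cast at h
        linarith
      · by_contra hc
        have e := stat4_snB hn σ hσ
        rw [if_neg hc] at e
        have := stat4_nonneg (σ * snB n)
        push_cast at h
        linarith
    · have := stat4_nonneg σ
      simp at h ⊢
      linarith
  | succ m ih =>
    intro σ hσ h
    push_cast at h
    by_cases h1 : ∀ i i' : Fin n, i'.val = i.val + 1 → σ (posC n i) < σ (posC n i')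
    · by_cases h2 : σ (lastCol n) < σ (mid n)
      · have := no_desc hn σ hσ h1 h2
        exact ⟨[], by simp, by simp [this], by simp [this, stat4_one]⟩
      · have e := stat4_snB hn σ hσ
        rw [if_neg h2] at e
        obtain ⟨w, w1, w2, w3⟩ := ih (σ * snB n)
          (fun k => by simp only [Equiv.Perm.mul_apply, snB_bar hn, hσ]) (by linarith)
        refine ⟨w ++ [snB n], ?_, ?_, ?_⟩
        · intro g hg
          rcases List.mem_append.1 hg with hg | hg
          · exact w1 g hg
          · rw [List.mem_singleton.1 hg]; exact Or.inr rfl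
        · rw [List.prod_append, w2, List.prod_singleton]
          ext a
          simp only [Equiv.Perm.mul_apply, snB_inv hn]
        · simp only [List.length_append, List.length_singleton]
          push_cast
          linarith
    · push Not at h1
      obtain ⟨i, i', hi, hd⟩ := h1
      have e := stat4_siB σ hσ i i' hi
      rw [if_neg hd.not_gt] at e
      obtain ⟨w, w1, w2, w3⟩ := ih (σ * siB n i i')
        (fun k => by simp only [Equiv.Perm.mul_apply, siB_bar i i' hi, hσ]) (by linarith)
      refine ⟨w ++ [siB n i i'], ?_, ?_, ?_⟩
      · intro g hg
        rcases List.mem_append.1 hg with hg | hg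
        · exact w1 g hg
        · rw [List.mem_singleton.1 hg]; exact Or.inl ⟨i, i', hi, rfl⟩
      · rw [List.prod_append, w2, List.prod_singleton]
        ext a
        simp only [Equiv.Perm.mul_apply, siB_inv i i' hi]
      · simp only [List.length_append, List.length_singleton]
        push_cast
        linarith

theorem lenB_stat (hn : 0 < n) (σ : Equiv.Perm (Col n)) (hσ : ∀ k, σ (barC n k) = barC n (σ k)) :
    4 * (lenB n σ : ℤ) = stat4 n σ := by
  obtain ⟨w, w1, w2, w3⟩ := word_exists hn (stat4 n σ).toNat σ hσ (by
    have := stat4_nonneg σ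
    omega)
  have hmem : w.length ∈ {m : ℕ | ∃ w : List (Equiv.Perm (Col n)),
    w.length = m ∧ (∀ g ∈ w, g ∈ gensB n) ∧ w.prod = σ} := ⟨w, rfl, w1, w2⟩
  have hle : lenB n σ ≤ w.length := Nat.sInf_le hmem
  obtain ⟨v, v1, v2, v3⟩ := Nat.sInf_mem ⟨_, hmem⟩
  have hv := (word_bound hn v v2).2
  rw [v3, v1] at hv
  change stat4 n σ ≤ 4 * (lenB n σ : ℤ) at hv
  omega

theorem lenB_siB (hn : 0 < n) (σ : Equiv.Perm (Col n)) (hσ : ∀ k, σ (barC n k) = barC n (σ k))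
    (i i' : Fin n) (h : i'.val = i.val + 1) (hlt : σ (posC n i) < σ (posC n i')) :
    lenB n ((siB n i i').trans σ) = lenB n σ + 1 := by
  have e1 := lenB_stat hn σ hσ
  have e2 := lenB_stat hn (σ * siB n i i')
    (fun k => by simp only [Equiv.Perm.mul_apply, siB_bar i i' h, hσ])
  have e3 := stat4_siB σ hσ i i' h
  rw [if_pos hlt] at e3
  change lenB n (σ * siB n i i') = lenB n σ + 1
  omega

end len


section final
variable {n L : ℕ}

theorem phi_eq (q ν t qh x : ℂ) (hν : ν ≠ 0) (hqh : qh ^ 2 * q = 1) (hx : x ≠ 0) :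
    q * x^2 * ((1 - ν * t * (qh * x⁻¹)) * (1 + ν⁻¹ * (qh * x⁻¹)))
      = q * x^2 + (q * qh * (ν⁻¹ - ν * t)) * x - t ∧
    q * x^2 * (1 - (qh * x⁻¹)^2) = q * x^2 - 1 := by
  constructor
  · field_simp
    linear_combination (-t * ν) * hqh
  · field_simp
    linear_combination (-1) * hqh

/-- Nondegeneracy conditions for a spectral parameter. -/
def good (s ν t qh x : ℂ) : Prop :=
  x ≠ 0 ∧ 1 - s * x ≠ 0 ∧ 1 - ν * t * (qh * x⁻¹) ≠ 0 ∧ 1 + ν⁻¹ * (qh * x⁻¹) ≠ 0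

theorem phi_good (q s ν t qh x : ℂ) (hq : q ≠ 0) (hν : ν ≠ 0) (hqh : qh ^ 2 * q = 1) (h : good s ν t qh x) :
    q * x^2 + (q * qh * (ν⁻¹ - ν * t)) * x - t ≠ 0 ∧
    phiF ν t (qh * x⁻¹) = (q * x^2 - 1) / (q * x^2 + (q * qh * (ν⁻¹ - ν * t)) * x - t) := by
  obtain ⟨h0, _, h1, h2⟩ := h
  obtain ⟨e1, e2⟩ := phi_eq q ν t qh x hν hqh h0
  have hqx : q * x^2 ≠ 0 := mul_ne_zero hq (pow_ne_zero 2 h0)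
  rw [← e1, ← e2]
  refine ⟨mul_ne_zero hqx (mul_ne_zero h1 h2), ?_⟩
  unfold phiF
  rw [mul_div_mul_left _ _ hqx]

/-- Relative sign factor. -/
noncomputable def ksg (n : ℕ) (q : ℂ) (c : Col n) : ℂ := if c < mid n then q else 1

theorem rF_ksg (q u : ℂ) (c : Col n) (hc : c ≠ mid n) : rF q u 1 c (mid n) = ksg n q c * (u - 1) := by
  unfold rF ksg
  have h : ¬ (c.val = (mid n).val) := fun e => hc (Fin.ext e)
  rw [if_neg h]
  simp only [Fin.lt_def]
  split_ifs <;> ring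

theorem siB_i (i i' : Fin n) (h : i'.val = i.val + 1) : siB n i i' (posC n i) = posC n i' := by
  apply Fin.ext
  rw [siB_val i i' h]
  simp [posC, h]

theorem siB_i' (i i' : Fin n) (h : i'.val = i.val + 1) : siB n i i' (posC n i') = posC n i := by
  apply Fin.ext
  rw [siB_val i i' h]
  simp [posC, h]

theorem siB_pos (i i' : Fin n) (h : i'.val = i.val + 1) (j : Fin n) :
    siB n i i' (posC n j) = posC n (Equiv.swap i i' j) := by
  have := j.isLt
  have := i'.isLt
  apply Fin.ext
  rw [siB_val i i' h]
  have e : ∀ k : Fin n, (posC n k).val = k.val := fun _ => rfl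
  have ej := e j
  rw [e (Equiv.swap i i' j), swap_val, h]
  split_ifs <;> omega

theorem pf_generic (q s ν t qh : ℂ) (x : Fin n → ℂ) (hq : q ≠ 0) (hs : s ≠ 0) (hν : ν ≠ 0)
    (hqh : qh ^ 2 * q = 1) (hg : ∀ j, good s ν t qh (x j))
    (σ : Equiv.Perm (Col n)) (hσ : ∀ k, σ (barC n k) = barC n (σ k))
    (μ : Fin n → ℤ) (i i' : Fin n) (hii' : i'.val = i.val + 1)
    (hord : σ (posC n i) < σ (posC n i'))
    (g1 : q * x i' - s ≠ 0) (g2 : q * x i - s ≠ 0) (g3 : q * x i' * x i - 1 ≠ 0) :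
    q * (x i' - x i) * ksg n q (σ (posC n i')) * pf n L q s ν t qh x ((siB n i i').trans σ) μ
      = (q - 1) * x i' * ksg n q (σ (posC n i)) * pf n L q s ν t qh x σ μ
       + (x i' - q * x i) * ksg n q (σ (posC n i)) * pf n L q s ν t qh (x ∘ Equiv.swap i i') σ μ := by
  have hmid : ∀ j, σ (posC n j) ≠ mid n := by
    intro j e
    rw [← sig_mid σ hσ] at e
    have := congrArg Fin.val (σ.injective e)
    have := j.isLt
    simp only [posC, mid] at *
    omega
  have hx' : ∀ j, 1 - s * (x ∘ Equiv.swap i i') j ≠ 0 := fun j => (hg _).2.1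
  rw [pf_ZZ q s ν t qh x hq hs (fun j => (hg j).2.1) σ, pf_ZZ q s ν t qh x hq hs (fun j => (hg j).2.1),
    pf_ZZ q s ν t qh _ hq hs hx' σ]
  have hprod : (∏ j, (s^2 / (1 - s * (x ∘ Equiv.swap i i') j)^2) ^ L) = ∏ j, (s^2 / (1 - s * x j)^2) ^ L :=
    Equiv.prod_comp (Equiv.swap i i') (fun j => (s^2 / (1 - s * x j)^2) ^ L)
  rw [hprod]
  have hi1 := i'.isLt
  have hi0 : i.val < n := i.isLt
  have ei : (⟨i.val, hi0⟩ : Fin n) = i := rfl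
  have ei' : ∀ h : i.val + 1 < n, (⟨i.val + 1, h⟩ : Fin n) = i' := fun h => Fin.ext hii'.symm
  obtain ⟨dX, pX⟩ := phi_good q s ν t qh (x i') hq hν hqh (hg i')
  obtain ⟨dY, pY⟩ := phi_good q s ν t qh (x i) hq hν hqh (hg i)
  have ex := exchange (n := n) q s t (x i') (x i) _ _ _ L hq hs (hg i').1 (hg i).1 (hg i').2.1 (hg i).2.1
    g1 g2 rfl rfl dX dY (σ (posC n i)) (σ (posC n i')) (hmid i) (hmid i') hord
  rw [← pX, ← pY, rF_ksg _ _ _ (hmid i), rF_ksg _ _ _ (hmid i')] at ex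
  have key := Zrec_exch
    (Dseq n L q s t (fun j => phiF ν t (qh*(x j)⁻¹)) x (fun j => σ (posC n j)))
    (Dseq n L q s t (fun j => phiF ν t (qh*(x j)⁻¹)) x (fun j => ((siB n i i').trans σ) (posC n j)))
    (Dseq n L q s t (fun j => phiF ν t (qh*((x ∘ Equiv.swap i i') j)⁻¹)) (x ∘ Equiv.swap i i')
      (fun j => σ (posC n j)))
    (q * (x i' - x i) * (ksg n q (σ (posC n i')) * (q * x i' * x i - 1)))
    (-((1 - q) * x i' * (ksg n q (σ (posC n i)) * (q * x i' * x i - 1))))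
    ((x i' - q * x i) * (ksg n q (σ (posC n i)) * (q * x i' * x i - 1))) i.val
    (by
      simp only [Dseq, dif_pos hi0, dif_pos (show i.val + 1 < n by omega), ei, ei', Equiv.trans_apply,
        siB_i i i' hii', siB_i' i i' hii', Function.comp, Equiv.swap_apply_left, Equiv.swap_apply_right]
      rw [← ex, neg_smul]
      abel)
    (by
      intro j h1 h2
      unfold Dseq
      split_ifs with hj
      · have : Equiv.swap i i' ⟨j, hj⟩ = ⟨j, hj⟩ := Equiv.swap_apply_of_ne_of_ne
          (fun e => h1 (congrArg Fin.val e)) (fun e => h2 ((congrArg Fin.val e).trans hii'))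
        simp only [Equiv.trans_apply, siB_pos i i' hii', this]
      · rfl)
    (by
      intro j h1 h2
      unfold Dseq
      split_ifs with hj
      · have : Equiv.swap i i' ⟨j, hj⟩ = ⟨j, hj⟩ := Equiv.swap_apply_of_ne_of_ne
          (fun e => h1 (congrArg Fin.val e)) (fun e => h2 ((congrArg Fin.val e).trans hii'))
        simp only [Function.comp, this]
      · rfl)
    n (by omega)
  have key2 := congrFun (LinearMap.congr_fun key (topI n L μ)) 0
  simp only [LinearMap.add_apply, LinearMap.smul_apply, Pi.add_apply, Pi.smul_apply, smul_eq_mul] at key2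
  apply mul_left_cancel₀ g3
  linear_combination (∏ j, (s^2 / (1 - s * x j)^2) ^ L) * key2

end final


section final2
variable {n L : ℕ}
open Filter Topology

theorem phiF_cont (s ν t qh x : ℂ) (h : good s ν t qh x) :
    ContinuousAt (fun z => phiF ν t (qh * z⁻¹)) x := by
  obtain ⟨h0, _, h1, h2⟩ := h
  unfold phiF
  have hi : ContinuousAt (fun z : ℂ => z⁻¹) x := continuousAt_inv₀ h0
  refine ContinuousAt.div (by fun_prop) (by fun_prop) (mul_ne_zero h1 h2)

theorem capW_cont (s ν t qh x : ℂ) (h : good s ν t qh x) (a b : Col n) :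
    ContinuousAt (fun z => capW n ν t qh z a b) x := by
  have := phiF_cont s ν t qh x h
  unfold capW
  split_ifs <;> fun_prop

theorem good_ev (s ν t qh : ℂ) (x : Fin n → ℂ) (h : ∀ j, good s ν t qh (x j)) :
    ∀ᶠ y in 𝓝 x, ∀ j, good s ν t qh (y j) := by
  rw [eventually_all]
  intro j
  have hj : ContinuousAt (fun y : Fin n → ℂ => y j) x := (continuous_apply j).continuousAt
  suffices hh : ∀ᶠ z in 𝓝 (x j), good s ν t qh z from hj.eventually hh
  obtain ⟨h0, h1, h2, h3⟩ := h j
  have hi : ContinuousAt (fun z : ℂ => z⁻¹) (x j) := continuousAt_inv₀ h0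
  have e0 : ContinuousAt (fun z : ℂ => z) (x j) := by fun_prop
  have e1 : ContinuousAt (fun z : ℂ => 1 - s * z) (x j) := by fun_prop
  have e2 : ContinuousAt (fun z : ℂ => 1 - ν * t * (qh * z⁻¹)) (x j) := by fun_prop
  have e3 : ContinuousAt (fun z : ℂ => 1 + ν⁻¹ * (qh * z⁻¹)) (x j) := by fun_prop
  filter_upwards [e0.eventually_ne h0, e1.eventually_ne h1, e2.eventually_ne h2, e3.eventually_ne h3]
    with z a b c d
  exact ⟨a, b, c, d⟩

theorem emN_cont (s : ℂ) (P : ℕ → ℂ) (j l : ℕ) : Continuous (fun z : ℂ => emN (z / s) P j l) := by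
  unfold emN hH
  split_ifs <;> fun_prop

theorem ellN_cont (s : ℂ) (P : ℕ → ℂ) (j l : ℕ) : Continuous (fun z : ℂ => ellN (z / s) P j l) := by
  unfold ellN gG
  split_ifs <;> fun_prop

theorem pf_cont (q s ν t qh : ℂ) (x : Fin n → ℂ) (hq : q ≠ 0) (hs : s ≠ 0)
    (hg : ∀ j, good s ν t qh (x j)) (σ : Equiv.Perm (Col n)) (μ : Fin n → ℤ) :
    ContinuousAt (fun y => pf n L q s ν t qh y σ μ) x := by
  classical
  have hev : (fun y => pf n L q s ν t qh y σ μ) =ᶠ[𝓝 x] fun y => ∑ h : HH n L, if BH σ μ h then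
      (∏ r : Fin (2*n), ∏ c : Fin L, preV s y r * wV q s y h r c) * capP ν t qh y h else 0 := by
    filter_upwards [good_ev s ν t qh x hg] with y hy
    rw [pf_sum q s ν t qh y hq hs (fun j => (hy j).2.1)]
  refine ContinuousAt.congr ?_ hev.symm
  refine tendsto_finsetSum _ fun h _ => ?_
  by_cases hb : BH σ μ h
  · simp only [if_pos hb]
    refine ContinuousAt.mul ?_ ?_
    · refine tendsto_finsetProd _ fun r _ => tendsto_finsetProd _ fun c _ => ?_
      have hr : ContinuousAt (fun y : Fin n → ℂ => y (hf r)) x := (continuous_apply _).continuousAt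
      refine ContinuousAt.mul ?_ ?_
      · unfold preV
        have hd := (hg (hf r)).2.1
        split_ifs
        · exact continuousAt_const.div (continuousAt_const.sub (continuousAt_const.mul hr)) hd
        · exact continuousAt_const.div (continuousAt_const.sub (continuousAt_const.mul hr)) hd
      · unfold wV
        split_ifs
        · exact ContinuousAt.comp (g := fun z : ℂ => emN (z / s) _ _ _) (f := fun y : Fin n → ℂ => y (hf r))
            (emN_cont s _ _ _).continuousAt hr
        · exact ContinuousAt.comp (g := fun z : ℂ => ellN (z / s) _ _ _) (f := fun y : Fin n → ℂ => y (hf r))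
            (ellN_cont s _ _ _).continuousAt hr
    · unfold capP
      refine tendsto_finsetProd _ fun j _ => ?_
      have hj : ContinuousAt (fun y : Fin n → ℂ => y j) x := (continuous_apply j).continuousAt
      exact ContinuousAt.comp (g := fun z => capW n ν t qh z (h (botR j, 0)) (h (topR j, 0)))
        (f := fun y : Fin n → ℂ => y j) (capW_cont s ν t qh (x j) (hg j) _ _) hj
  · simp only [if_neg hb]
    exact continuousAt_const

theorem ev_lin (q a s : ℂ) (hq : q ≠ 0) : ∀ᶠ e in 𝓝[≠] (0:ℂ), q * (a + e) - s ≠ 0 := by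
  by_cases h : q * a - s = 0
  · filter_upwards [self_mem_nhdsWithin] with e he
    have : q * (a + e) - s = q * e := by linear_combination h
    rw [this]
    exact mul_ne_zero hq he
  · have c : ContinuousAt (fun e : ℂ => q * (a + e) - s) 0 := by fun_prop
    exact (c.eventually_ne (by simpa using h)).filter_mono nhdsWithin_le_nhds

theorem ev_quad (q a b : ℂ) (hq : q ≠ 0) : ∀ᶠ e in 𝓝[≠] (0:ℂ), q * (a + e) * (b + e) - 1 ≠ 0 := by
  by_cases h : q * a * b - 1 = 0
  · filter_upwards [self_mem_nhdsWithin, ev_lin q (a + b) 0 hq] with e he he2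
    have : q * (a + e) * (b + e) - 1 = e * (q * (a + b + e) - 0) := by linear_combination h
    rw [this]
    exact mul_ne_zero he he2
  · have c : ContinuousAt (fun e : ℂ => q * (a + e) * (b + e) - 1) 0 := by fun_prop
    exact (c.eventually_ne (by simpa using h)).filter_mono nhdsWithin_le_nhds

theorem pf_exch (q s ν t qh : ℂ) (x : Fin n → ℂ) (hq : q ≠ 0) (hs : s ≠ 0) (hν : ν ≠ 0)
    (hqh : qh ^ 2 * q = 1) (hg : ∀ j, good s ν t qh (x j))
    (σ : Equiv.Perm (Col n)) (hσ : ∀ k, σ (barC n k) = barC n (σ k))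
    (μ : Fin n → ℤ) (i i' : Fin n) (hii' : i'.val = i.val + 1)
    (hord : σ (posC n i) < σ (posC n i')) :
    q * (x i' - x i) * ksg n q (σ (posC n i')) * pf n L q s ν t qh x ((siB n i i').trans σ) μ
      = (q - 1) * x i' * ksg n q (σ (posC n i)) * pf n L q s ν t qh x σ μ
       + (x i' - q * x i) * ksg n q (σ (posC n i)) * pf n L q s ν t qh (x ∘ Equiv.swap i i') σ μ := by
  have c1 := pf_cont (L := L) q s ν t qh x hq hs hg ((siB n i i').trans σ) μ
  have c2 := pf_cont (L := L) q s ν t qh x hq hs hg σ μ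
  have c3' := pf_cont (L := L) q s ν t qh (x ∘ Equiv.swap i i') hq hs (fun j => hg _) σ μ
  have hsw : ContinuousAt (fun y : Fin n → ℂ => y ∘ Equiv.swap i i') x := by
    apply Continuous.continuousAt
    exact continuous_pi fun j => continuous_apply _
  have c3 : ContinuousAt (fun y : Fin n → ℂ => pf n L q s ν t qh (y ∘ Equiv.swap i i') σ μ) x :=
    ContinuousAt.comp (g := fun y => pf n L q s ν t qh y σ μ)
      (f := fun y : Fin n → ℂ => y ∘ Equiv.swap i i') c3' hsw
  have ci : ContinuousAt (fun y : Fin n → ℂ => y i) x := (continuous_apply i).continuousAt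
  have ci' : ContinuousAt (fun y : Fin n → ℂ => y i') x := (continuous_apply i').continuousAt
  have cl : ContinuousAt (fun y : Fin n → ℂ =>
      q * (y i' - y i) * ksg n q (σ (posC n i')) * pf n L q s ν t qh y ((siB n i i').trans σ) μ) x := by
    fun_prop
  have cr : ContinuousAt (fun y : Fin n → ℂ =>
      (q - 1) * y i' * ksg n q (σ (posC n i)) * pf n L q s ν t qh y σ μ
       + (y i' - q * y i) * ksg n q (σ (posC n i)) * pf n L q s ν t qh (y ∘ Equiv.swap i i') σ μ) x := by
    refine ContinuousAt.add (ContinuousAt.mul ?_ c2) (ContinuousAt.mul ?_ c3)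
    · exact (continuousAt_const.mul ci').mul continuousAt_const
    · exact (ci'.sub (continuousAt_const.mul ci)).mul continuousAt_const
  have hpath : Tendsto (fun (e : ℂ) (j : Fin n) => x j + e) (𝓝[≠] 0) (𝓝 x) := by
    have : Continuous (fun (e : ℂ) (j : Fin n) => x j + e) := by fun_prop
    have h0 := this.tendsto 0
    simp only [add_zero] at h0
    exact h0.mono_left nhdsWithin_le_nhds
  have t1 := cl.tendsto.comp hpath
  have t2 := cr.tendsto.comp hpath
  refine tendsto_nhds_unique_of_eventuallyEq t1 t2 ?_
  filter_upwards [hpath.eventually (good_ev s ν t qh x hg), ev_lin q (x i') s hq, ev_lin q (x i) s hq,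
    ev_quad q (x i') (x i) hq] with e h1 h2 h3 h4
  exact pf_generic q s ν t qh (fun j => x j + e) hq hs hν hqh h1 σ hσ μ i i' hii' hord h2 h3 h4

end final2


section final3
variable {n L : ℕ}

theorem wsum (σ : Equiv.Perm (Col n)) (i i' : Fin n) (h : i'.val = i.val + 1)
    (hord : σ (posC n i) < σ (posC n i')) :
    (∑ j : Fin n, (n - 1 - j.val) * (if ((siB n i i').trans σ) (posC n j) < mid n then 1 else 0))
      + (if σ (posC n i) < mid n ∧ ¬ σ (posC n i') < mid n then 1 else 0)
    = ∑ j : Fin n, (n - 1 - j.val) * (if σ (posC n j) < mid n then 1 else 0) := by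
  have hne : i' ≠ i := fun e => by rw [e] at h; omega
  have hm : i' ∈ Finset.univ.erase i := by simp [hne]
  rw [← Finset.add_sum_erase _ _ (Finset.mem_univ i), ← Finset.add_sum_erase _ _ hm]
  rw [← Finset.add_sum_erase Finset.univ (fun j : Fin n => (n - 1 - j.val) * (if σ (posC n j) < mid n then 1 else 0))
    (Finset.mem_univ i), ← Finset.add_sum_erase (Finset.univ.erase i)
      (fun j : Fin n => (n - 1 - j.val) * (if σ (posC n j) < mid n then 1 else 0)) hm]
  have hrest : ∑ j ∈ (Finset.univ.erase i).erase i', (n - 1 - j.val) *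
        (if ((siB n i i').trans σ) (posC n j) < mid n then 1 else 0)
      = ∑ j ∈ (Finset.univ.erase i).erase i', (n - 1 - j.val) * (if σ (posC n j) < mid n then 1 else 0) := by
    refine Finset.sum_congr rfl fun j hj => ?_
    simp only [Finset.mem_erase, Finset.mem_univ, and_true] at hj
    rw [Equiv.trans_apply, siB_pos i i' h, Equiv.swap_apply_of_ne_of_ne hj.2 hj.1]
  rw [hrest]
  simp only [Equiv.trans_apply, siB_i i i' h, siB_i' i i' h]
  have hi := i'.isLt
  by_cases hA : σ (posC n i) < mid n
  · by_cases hB : σ (posC n i') < mid n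
    · simp [hA, hB]
    · simp only [hA, hB, if_true, if_false, not_false_eq_true, and_self, mul_one, mul_zero]
      omega
  · have hB : ¬ σ (posC n i') < mid n := fun hB => hA (hord.trans hB)
    simp [hA, hB]

end final3

/-- Hecke-type recursion for the normalized partition function
at `s_i`, `1 ≤ i ≤ n-1`; `i, i'` are the 0-indexed positions of the paper's
`i, i+1`: `F_μ^{σ s_i} = T_i F_μ^σ`. -/
theorem normalized_recursion_si (n L : ℕ) (hn : 0 < n) (hL : 0 < L)
    (q s ν t qh : ℂ) (x r : Fin n → ℂ)
    (hq : q ≠ 0) (hs : s ≠ 0) (hν : ν ≠ 0) (hqh : qh ^ 2 * q = 1)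
    (hr : ∀ j, (r j) ^ 2 = ((x j) ^ 2 - q) / (1 - q * (x j) ^ 2))
    (hx0 : ∀ j, x j ≠ 0) (hsx : ∀ j, 1 - s * x j ≠ 0) (hxs : ∀ j, s - x j ≠ 0)
    (hqx : ∀ j, 1 - q * (x j) ^ 2 ≠ 0)
    (hc1 : ∀ j, 1 - ν * t * (qh * (x j)⁻¹) ≠ 0)
    (hc2 : ∀ j, 1 + ν⁻¹ * (qh * (x j)⁻¹) ≠ 0)
    (σ : Equiv.Perm (Col n)) (hσ : ∀ k, σ (barC n k) = barC n (σ k))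
    (μ : Fin n → ℤ) (hμ : ∀ j, 1 ≤ |μ j| ∧ |μ j| ≤ (L : ℤ))
    (i i' : Fin n) (hii' : (i' : ℕ) = (i : ℕ) + 1)
    (hord : σ (posC n i) < σ (posC n i'))
    (hxx : x i ≠ x i') :
    Fnorm n L q s ν t qh x r ((siB n i i').trans σ) μ
      = ((q - 1) * x i' / (x i' - x i)) * Fnorm n L q s ν t qh x r σ μ
        + ((x i' - q * x i) / (x i' - x i))
          * Fnorm n L q s ν t qh (x ∘ Equiv.swap i i') (r ∘ Equiv.swap i i') σ μ := by
  have hg : ∀ j, good s ν t qh (x j) := fun j => ⟨hx0 j, hsx j, hc1 j, hc2 j⟩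
  have hpf := pf_exch (L := L) q s ν t qh x hq hs hν hqh hg σ hσ μ i i' hii' hord
  have hw := wsum σ i i' hii' hord
  have hlen := lenB_siB hn σ hσ i i' hii' hord
  have hneg : ∀ {M : Type} [AddCommMonoid M] (u v : M),
      (∑ j : Fin n, if mid n < ((siB n i i').trans σ) (posC n j) then u else v)
        = ∑ j : Fin n, if mid n < σ (posC n j) then u else v := by
    intro M _ u v
    simp only [Equiv.trans_apply, siB_pos i i' hii']
    exact Equiv.sum_comp (Equiv.swap i i') (fun j => if mid n < σ (posC n j) then u else v)
  have hP : (∏ j : Fin n, ((1 - s * (x ∘ Equiv.swap i i') j) / (s - (x ∘ Equiv.swap i i') j)) ^ L)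
      = ∏ j : Fin n, ((1 - s * x j) / (s - x j)) ^ L :=
    Equiv.prod_comp (Equiv.swap i i') (fun j => ((1 - s * x j) / (s - x j)) ^ L)
  have hR : (∏ j : Fin n, (r ∘ Equiv.swap i i') j) = ∏ j : Fin n, r j :=
    Equiv.prod_comp (Equiv.swap i i') r
  unfold Fnorm
  rw [hneg, hneg, hP, hR, hlen, ← hw]
  have hX : x i' - x i ≠ 0 := sub_ne_zero.2 (Ne.symm hxx)
  generalize (∑ j : Fin n, (n - 1 - j.val) *
    (if ((siB n i i').trans σ) (posC n j) < mid n then 1 else 0)) = S at hw ⊢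
  generalize s ^ (-(2 * (L : ℤ) * (∑ j : Fin n, if mid n < σ (posC n j) then (1 : ℤ) else 0))) = C1
  generalize (t / q) ^ (∑ j : Fin n, if mid n < σ (posC n j) then 1 else 0) = C2
  generalize (∏ j : Fin n, ((1 - s * x j) / (s - x j)) ^ L) = C3
  generalize (∏ j : Fin n, r j) = C4
  generalize pf n L q s ν t qh x ((siB n i i').trans σ) μ = f1 at hpf ⊢
  generalize pf n L q s ν t qh x σ μ = f2 at hpf ⊢
  generalize pf n L q s ν t qh (x ∘ Equiv.swap i i') σ μ = f3 at hpf ⊢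
  have hk : ksg n q (σ (posC n i)) ≠ 0 := by
    unfold ksg
    split_ifs
    · exact hq
    · exact one_ne_zero
  have hQ : q ^ (lenB n σ + 1 + S) * ksg n q (σ (posC n i))
      = q ^ (lenB n σ + (S + if σ (posC n i) < mid n ∧ ¬ σ (posC n i') < mid n then 1 else 0))
        * (q * ksg n q (σ (posC n i'))) := by
    unfold ksg
    by_cases hA : σ (posC n i) < mid n
    · by_cases hB : σ (posC n i') < mid n
      · simp only [hA, hB, if_true, not_true_eq_false, and_false, if_false]
        ring
      · simp only [hA, hB, if_true, if_false, not_false_eq_true, and_self]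
        ring
    · have hB : ¬ σ (posC n i') < mid n := fun hB => hA (hord.trans hB)
      simp only [hA, hB, if_false, false_and]
      ring
  generalize q ^ (lenB n σ + 1 + S) = Q1 at hQ ⊢
  generalize q ^ (lenB n σ + (S + if σ (posC n i) < mid n ∧ ¬ σ (posC n i') < mid n then 1 else 0)) = Q2
    at hQ ⊢
  apply mul_left_cancel₀ (mul_ne_zero hk hX)
  have h1 : (q - 1) * x i' / (x i' - x i) * (x i' - x i) = (q - 1) * x i' := div_mul_cancel₀ _ hX
  have h2 : (x i' - q * x i) / (x i' - x i) * (x i' - x i) = x i' - q * x i := div_mul_cancel₀ _ hX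
  linear_combination (x i' - x i) * C1 * C2 * C3 * C4 * f1 * hQ + Q2 * C1 * C2 * C3 * C4 * hpf
    - ksg n q (σ (posC n i)) * Q2 * C1 * C2 * C3 * C4 * f2 * h1
    - ksg n q (σ (posC n i)) * Q2 * C1 * C2 * C3 * C4 * f3 * h2
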